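/- arXiv:1001.4548 — 10 statements merged into one kernel-verified Lean document; each statement's English description precedes it below -/
import Mathlib

section
/- For every m ≥ 1, M = 2^m, and every M×N real input alphabet X with Es > 0, the first-order coefficient of the constellation [X, N_m, U_M] (NBC labeling, uniform distribution) equals α(X, N_m) = (log₂ e / Es) Σ_{k=0}^{m−1} ‖x̃_{2^k}‖², where x̃_j are the rows of the Hadamard transform X̃ = (1/M)·H·X. -/
/-- Recursively defined Hadamard matrix of order `2^m`. -/
def had : ℕ → ℕ → ℕ → ℝ
  | 0, _, _ => 1
  | m+1, i, j =>
      if i < 2^m then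
        if j < 2^m then had m i j else had m i (j - 2^m)
      else
        if j < 2^m then had m (i - 2^m) j else - had m (i - 2^m) (j - 2^m)

/-- Natural binary code of order `m` (`c_{i,k} = b_{m-1-k}(i)`, MSB first). -/
def nbc (m i k : ℕ) : Bool := Nat.testBit i (m - 1 - k)

/-- Modified labeling matrix: `q_{i,k} = -1` if `c_{i,m-1-k} = 1`, `+1` otherwise. -/
def Qmat (m : ℕ) (c : ℕ → ℕ → Bool) (i k : ℕ) : ℝ :=
  if c i (m - 1 - k) then -1 else 1

theorem had_zero_left (m i : ℕ) : had m 0 i = 1 := by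
  induction m generalizing i with
  | zero => simp [had]
  | succ m ih => simp [had, ih]

theorem had_two_pow (m k i : ℕ) (hk : k < m) (hi : i < 2^m) :
    had m (2^k) i = if Nat.testBit i k then -1 else 1 := by
  induction m generalizing i with
  | zero => omega
  | succ m ih =>
    rw [pow_succ] at hi
    rcases Nat.lt_succ_iff_lt_or_eq.mp hk with h | h
    · have h1 : 2^k < 2^m := Nat.pow_lt_pow_right (by norm_num) h
      by_cases hj : i < 2^m
      · simp only [had, h1, hj, if_true]
        exact ih i h hj
      · simp only [had, h1, hj, if_true, if_false]
        rw [ih (i - 2^m) h (by omega)]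
        obtain ⟨t, rfl⟩ := Nat.exists_eq_add_of_le (not_lt.mp hj)
        rw [Nat.add_sub_cancel_left, Nat.testBit_two_pow_add_gt h]
    · subst h
      by_cases hj : i < 2^k
      · simp [had, hj, had_zero_left, Nat.testBit_lt_two_pow hj]
      · obtain ⟨t, rfl⟩ := Nat.exists_eq_add_of_le (not_lt.mp hj)
        have ht : t < 2^k := by omega
        simp [had, had_zero_left, Nat.testBit_two_pow_add_eq, Nat.testBit_lt_two_pow ht]

/-- The first-order coefficient of the constellation `[X, N_m, U_M]` equals
`(log₂ e / Es) Σ_{k<m} ‖x̃_{2^k}‖²` where `x̃_j = (1/M) Σ_i h_{j,i} x_i` is the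
Hadamard transform of `X`. -/
theorem alpha_nbc_hadamard (m N : ℕ) (hm : 1 ≤ m)
    (x : ℕ → EuclideanSpace ℝ (Fin N)) (Es : ℝ)
    (hEs : Es = (2^m : ℝ)⁻¹ * ∑ i ∈ Finset.range (2^m), ‖x i‖^2)
    (hEspos : 0 < Es) :
    (Real.logb 2 (Real.exp 1) / Es) *
      ∑ k ∈ Finset.range m,
        ‖(2^m : ℝ)⁻¹ • ∑ i ∈ Finset.range (2^m), Qmat m (nbc m) i k • x i‖^2
    = (Real.logb 2 (Real.exp 1) / Es) *
      ∑ k ∈ Finset.range m,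
        ‖(2^m : ℝ)⁻¹ • ∑ i ∈ Finset.range (2^m), had m (2^k) i • x i‖^2 := by
  congr 1
  refine Finset.sum_congr rfl fun k hk => ?_
  have hk' := Finset.mem_range.mp hk
  congr 3
  refine Finset.sum_congr rfl fun i hi => ?_
  rw [had_two_pow m k i hk' (Finset.mem_range.mp hi)]
  have e : m - 1 - (m - 1 - k) = k := by omega
  simp only [Qmat, nbc, e]
end

section
/- For every m ≥ 1, M = 2^m, every binary labeling L of order m, and every M×N real input alphabet X with Es > 0, the first-order coefficient satisfies α(X, L) ≤ log₂ e; equivalently, Σ_{k=0}^{m−1} ‖(1/M) Σ_{i=0}^{M−1} q_{i,k} x_i‖² ≤ (1/M) Σ_{i=0}^{M−1} ‖x_i‖². -/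
lemma sgn_orth (m : ℕ) (a b : Fin m) (hab : a ≠ b) :
    ∑ f : Fin m → Bool, (if f a then (-1 : ℝ) else 1) * (if f b then (-1 : ℝ) else 1) = 0 := by
  have hinv : Function.Involutive
      (fun f : Fin m → Bool => Function.update f a (!(f a))) := by
    intro f
    simp
  have h := Equiv.sum_comp (Function.Involutive.toPerm _ hinv)
    (fun f : Fin m → Bool => (if f a then (-1 : ℝ) else 1) * (if f b then (-1 : ℝ) else 1))
  have h2 : ∀ f : Fin m → Bool,
      (if (Function.Involutive.toPerm _ hinv f) a then (-1 : ℝ) else 1) * (if (Function.Involutive.toPerm _ hinv f) b then (-1 : ℝ) else 1)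
      = - ((if f a then (-1 : ℝ) else 1) * (if f b then (-1 : ℝ) else 1)) := by
    intro f
    have e1 : (Function.Involutive.toPerm _ hinv f) a = !(f a) := by simp [Function.Involutive.toPerm]
    have e2 : (Function.Involutive.toPerm _ hinv f) b = f b := by
      simp [Function.Involutive.toPerm, Function.update_of_ne hab.symm]
    rw [e1, e2]
    cases f a <;> cases f b <;> simp
  simp only [h2, Finset.sum_neg_distrib] at h
  linarith

lemma Qmat_orth (m : ℕ) (c : ℕ → ℕ → Bool)
    (hc : ∀ i < 2^m, ∀ j < 2^m, (∀ k < m, c i k = c j k) → i = j)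
    (k l : ℕ) (hk : k < m) (hl : l < m) :
    ∑ i ∈ Finset.range (2^m), Qmat m c i k * Qmat m c i l = if k = l then (2^m : ℝ) else 0 := by
  split_ifs with h
  · subst h
    have : ∀ i, Qmat m c i k * Qmat m c i k = 1 := by
      intro i
      unfold Qmat
      split_ifs <;> norm_num
    simp [this]
  · have hbij : Function.Bijective
        (fun (i : Fin (2^m)) (k : Fin m) => c i k) := by
      rw [Fintype.bijective_iff_injective_and_card]
      refine ⟨?_, by simp⟩
      intro i j hij
      apply Fin.ext
      exact hc i i.2 j j.2 (fun k hk => congrFun hij ⟨k, hk⟩)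
    rw [Finset.sum_range]
    have := sgn_orth m ⟨m - 1 - k, by omega⟩ ⟨m - 1 - l, by omega⟩
      (by intro e; rw [Fin.mk.injEq] at e; omega)
    rw [← this, ← (Equiv.ofBijective _ hbij).sum_comp]
    rfl

lemma bessel_aux (m N : ℕ) (c : ℕ → ℕ → Bool)
    (hc : ∀ i < 2^m, ∀ j < 2^m, (∀ k < m, c i k = c j k) → i = j)
    (x : ℕ → EuclideanSpace ℝ (Fin N)) :
    ∑ k ∈ Finset.range m,
        ‖(2^m : ℝ)⁻¹ • ∑ i ∈ Finset.range (2^m), Qmat m c i k • x i‖^2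
      ≤ (2^m : ℝ)⁻¹ * ∑ i ∈ Finset.range (2^m), ‖x i‖^2 := by
  have hM : (0 : ℝ) < 2^m := by positivity
  obtain ⟨y, hy⟩ : ∃ y : ℕ → EuclideanSpace ℝ (Fin N),
    ∀ k, y k = (2^m : ℝ)⁻¹ • ∑ i ∈ Finset.range (2^m), Qmat m c i k • x i := ⟨_, fun _ => rfl⟩
  have hy' : ∀ k, ∑ i ∈ Finset.range (2^m), Qmat m c i k • x i = (2^m : ℝ) • y k := by
    intro k
    rw [hy, smul_smul, mul_inv_cancel₀ hM.ne', one_smul]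
  simp only [← hy]
  have h0 : 0 ≤ ∑ i ∈ Finset.range (2^m),
      ‖x i - ∑ k ∈ Finset.range m, Qmat m c i k • y k‖^2 :=
    Finset.sum_nonneg fun _ _ => by positivity
  simp only [norm_sub_sq_real, Finset.sum_add_distrib, Finset.sum_sub_distrib,
    ← Finset.mul_sum] at h0
  have h1 : ∑ i ∈ Finset.range (2^m), inner ℝ (x i) (∑ k ∈ Finset.range m, Qmat m c i k • y k)
      = 2^m * ∑ k ∈ Finset.range m, ‖y k‖^2 := by
    simp only [inner_sum]
    rw [Finset.sum_comm, Finset.mul_sum]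
    refine Finset.sum_congr rfl fun k _ => ?_
    have : ∀ i, inner ℝ (x i) (Qmat m c i k • y k) = inner ℝ (Qmat m c i k • x i) (y k) := by
      intro i
      rw [real_inner_smul_left, real_inner_smul_right]
    simp only [this]
    rw [← sum_inner, hy', real_inner_smul_left, real_inner_self_eq_norm_sq]
  have h2 : ∑ i ∈ Finset.range (2^m), ‖∑ k ∈ Finset.range m, Qmat m c i k • y k‖^2
      = 2^m * ∑ k ∈ Finset.range m, ‖y k‖^2 := by
    simp only [← real_inner_self_eq_norm_sq, inner_sum, sum_inner, real_inner_smul_left,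
      real_inner_smul_right]
    rw [Finset.sum_comm, Finset.mul_sum]
    refine Finset.sum_congr rfl fun k hk => ?_
    rw [Finset.sum_comm]
    rw [Finset.sum_eq_single k]
    · simp only [← mul_assoc, ← Finset.sum_mul]
      rw [Qmat_orth m c hc k k (Finset.mem_range.1 hk) (Finset.mem_range.1 hk), if_pos rfl]
    · intro l hl hlk
      simp only [← mul_assoc, ← Finset.sum_mul]
      first
      | rw [Qmat_orth m c hc l k (Finset.mem_range.1 hl) (Finset.mem_range.1 hk), if_neg hlk,
          zero_mul]
      | rw [Qmat_orth m c hc k l (Finset.mem_range.1 hk) (Finset.mem_range.1 hl),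
          if_neg hlk.symm, zero_mul]
    · intro h
      exact absurd hk h
  rw [h1, h2] at h0
  rw [le_inv_mul_iff₀ hM]
  linarith

/-- For any binary labeling and any input alphabet with `Es > 0`, the first-order
coefficient satisfies `α(X,L) ≤ log₂ e`; equivalently
`Σ_{k<m} ‖(1/M) Σ_i q_{i,k} x_i‖² ≤ (1/M) Σ_i ‖x_i‖²`. -/
theorem alpha_le_log2e (m N : ℕ) (hm : 1 ≤ m)
    (c : ℕ → ℕ → Bool)
    (hc : ∀ i < 2^m, ∀ j < 2^m, (∀ k < m, c i k = c j k) → i = j)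
    (x : ℕ → EuclideanSpace ℝ (Fin N)) (Es : ℝ)
    (hEs : Es = (2^m : ℝ)⁻¹ * ∑ i ∈ Finset.range (2^m), ‖x i‖^2)
    (hEspos : 0 < Es) :
    (Real.logb 2 (Real.exp 1) / Es) *
        ∑ k ∈ Finset.range m,
          ‖(2^m : ℝ)⁻¹ • ∑ i ∈ Finset.range (2^m), Qmat m c i k • x i‖^2
      ≤ Real.logb 2 (Real.exp 1) ∧
    ∑ k ∈ Finset.range m,
        ‖(2^m : ℝ)⁻¹ • ∑ i ∈ Finset.range (2^m), Qmat m c i k • x i‖^2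
      ≤ (2^m : ℝ)⁻¹ * ∑ i ∈ Finset.range (2^m), ‖x i‖^2 := by
  have h := bessel_aux m N c hc x
  refine ⟨?_, h⟩
  rw [← hEs] at h
  have hl : 0 ≤ Real.logb 2 (Real.exp 1) :=
    Real.logb_nonneg (by norm_num) (Real.one_le_exp (by norm_num))
  rw [div_mul_eq_mul_div, div_le_iff₀ hEspos]
  exact mul_le_mul_of_nonneg_left h hl
end

section
/- Let m ≥ 1, M = 2^m, and let v_0,…,v_{m−1} be nonzero real numbers such that the M sums ±v_0 ± v_1 ± ⋯ ± v_{m−1} (over all sign patterns) are distinct and nonzero. If the one-dimensional input alphabet X (an M×1 matrix) has as its entries exactly these M points, then there exists a binary labeling L of order m such that the constellation [X, L, U_M] is first-order optimal. -/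
/-- Orthogonality of distinct sign coordinates over the cube. -/
lemma sign_orth (m : ℕ) (k l : Fin m) (hkl : k ≠ l) :
    ∑ f : Fin m → Bool, (if f k then (1:ℝ) else -1) * (if f l then (1:ℝ) else -1) = 0 := by
  refine Finset.sum_involution (fun f _ => Function.update f k (!(f k))) ?_ ?_ ?_ ?_
  · intro f _
    rw [Function.update_self, Function.update_of_ne hkl.symm]
    cases f k <;> cases f l <;> simp
  · intro f _ _ h
    have := congrFun h k
    simp at this
  · intro f _
    exact Finset.mem_univ _
  · intro f _
    simp

/-- If a nonequally spaced `M`-PAM input alphabet consists of the `M` distinct nonzero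
points `±v_0 ± v_1 ± ⋯ ± v_{m-1}` (with all `v_k ≠ 0`), then there exists a binary
labeling `L` such that `[X, L, U_M]` is first-order optimal. -/
theorem nes_pam_foo (m : ℕ) (hm : 1 ≤ m) (v : ℕ → ℝ)
    (hv : ∀ k < m, v k ≠ 0)
    (hdistinct : ∀ ε ε' : ℕ → Bool,
      (∑ k ∈ Finset.range m, (if ε k then (1:ℝ) else -1) * v k)
        = (∑ k ∈ Finset.range m, (if ε' k then (1:ℝ) else -1) * v k) →
      ∀ k < m, ε k = ε' k)
    (hnonzero : ∀ ε : ℕ → Bool,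
      (∑ k ∈ Finset.range m, (if ε k then (1:ℝ) else -1) * v k) ≠ 0)
    (x : ℕ → ℝ)
    (hx : ∀ i < 2^m, ∃ ε : ℕ → Bool,
      x i = ∑ k ∈ Finset.range m, (if ε k then (1:ℝ) else -1) * v k)
    (hinj : ∀ i < 2^m, ∀ j < 2^m, x i = x j → i = j) :
    ∃ c : ℕ → ℕ → Bool,
      (∀ i < 2^m, ∀ j < 2^m, (∀ k < m, c i k = c j k) → i = j) ∧
      (Real.logb 2 (Real.exp 1) /
          ((2^m : ℝ)⁻¹ * ∑ i ∈ Finset.range (2^m), x i ^ 2)) *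
        ∑ k ∈ Finset.range m,
          ((2^m : ℝ)⁻¹ * ∑ i ∈ Finset.range (2^m), Qmat m c i k * x i)^2
      = Real.logb 2 (Real.exp 1) := by
  choose! ε hε using hx
  have hb : Function.Bijective
      (fun (i : Fin (2^m)) => (fun (k : Fin m) => ε i k)) := by
    rw [Fintype.bijective_iff_injective_and_card]
    refine ⟨?_, by simp⟩
    intro i j hij
    apply Fin.ext
    apply hinj i i.2 j j.2
    rw [hε i i.2, hε j j.2]
    apply Finset.sum_congr rfl
    intro k hk
    have := congrFun hij ⟨k, Finset.mem_range.1 hk⟩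
    simp only at this
    rw [this]
  have horth : ∀ k < m, ∀ l < m,
      ∑ i ∈ Finset.range (2^m), (if ε i k then (1:ℝ) else -1) * (if ε i l then (1:ℝ) else -1)
        = if k = l then (2^m : ℝ) else 0 := by
    intro k hk l hl
    split_ifs with h
    · subst h
      rw [Finset.sum_congr rfl (g := fun _ => (1:ℝ))]
      · simp
      · intro i _
        split_ifs <;> norm_num
    · rw [← sign_orth m ⟨k, hk⟩ ⟨l, hl⟩ (by simpa using h), Finset.sum_range]
      exact hb.sum_comp (fun f : Fin m → Bool =>
        (if f ⟨k, hk⟩ then (1:ℝ) else -1) * (if f ⟨l, hl⟩ then (1:ℝ) else -1))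
  have hcorr : ∀ k < m,
      ∑ i ∈ Finset.range (2^m), (if ε i k then (1:ℝ) else -1) * x i = 2^m * v k := by
    intro k hk
    calc _ = ∑ i ∈ Finset.range (2^m), ∑ l ∈ Finset.range m,
          ((if ε i k then (1:ℝ) else -1) * (if ε i l then (1:ℝ) else -1)) * v l := by
            apply Finset.sum_congr rfl
            intro i hi
            rw [hε i (Finset.mem_range.1 hi), Finset.mul_sum]
            apply Finset.sum_congr rfl
            intro l _
            ring
      _ = ∑ l ∈ Finset.range m, (if k = l then (2^m : ℝ) else 0) * v l := by
            rw [Finset.sum_comm]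
            apply Finset.sum_congr rfl
            intro l hl
            rw [← Finset.sum_mul, horth k hk l (Finset.mem_range.1 hl)]
      _ = 2^m * v k := by
            simp [ite_mul, hk]
  have hen : ∑ i ∈ Finset.range (2^m), x i ^ 2 = 2^m * ∑ k ∈ Finset.range m, v k ^ 2 := by
    calc _ = ∑ i ∈ Finset.range (2^m), ∑ l ∈ Finset.range m,
          v l * ((if ε i l then (1:ℝ) else -1) * x i) := by
            apply Finset.sum_congr rfl
            intro i hi
            rw [sq]
            nth_rewrite 1 [hε i (Finset.mem_range.1 hi)]
            rw [Finset.sum_mul]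
            apply Finset.sum_congr rfl
            intro l _
            ring
      _ = _ := by
            rw [Finset.sum_comm, Finset.mul_sum]
            apply Finset.sum_congr rfl
            intro l hl
            rw [← Finset.mul_sum, hcorr l (Finset.mem_range.1 hl)]
            ring
  have hpos : 0 < ∑ k ∈ Finset.range m, v k ^ 2 := by
    apply Finset.sum_pos
    · intro k hk
      have := hv k (Finset.mem_range.1 hk)
      positivity
    · exact ⟨0, Finset.mem_range.2 hm⟩
  have h2 : (2^m : ℝ) ≠ 0 := by positivity
  refine ⟨fun i j => !(ε i (m - 1 - j)), ?_, ?_⟩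
  · intro i hi j hj h
    apply hinj i hi j hj
    rw [hε i hi, hε j hj]
    apply Finset.sum_congr rfl
    intro k hk
    have hk' := Finset.mem_range.1 hk
    have := h (m - 1 - k) (by omega)
    have e : m - 1 - (m - 1 - k) = k := by omega
    simp only [e, Bool.not_inj_iff] at this
    rw [this]
  · have hq : ∑ k ∈ Finset.range m, ((2^m : ℝ)⁻¹ * ∑ i ∈ Finset.range (2^m),
        Qmat m (fun i j => !(ε i (m - 1 - j))) i k * x i)^2
        = ∑ k ∈ Finset.range m, v k ^ 2 := by
      apply Finset.sum_congr rfl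
      intro k hk
      have hk' := Finset.mem_range.1 hk
      have e : m - 1 - (m - 1 - k) = k := by omega
      have : ∑ i ∈ Finset.range (2^m),
          Qmat m (fun i j => !(ε i (m - 1 - j))) i k * x i = 2^m * v k := by
        rw [← hcorr k hk']
        apply Finset.sum_congr rfl
        intro i _
        simp only [Qmat, e]
        cases ε i k <;> simp
      rw [this, inv_mul_cancel_left₀ h2]
    rw [hq, hen, inv_mul_cancel_left₀ h2]
    exact div_mul_cancel₀ _ hpos.ne'
end

section
/- Let m ≥ 1, M = 2^m, and let X_PAM be the M-PAM input alphabet. A constellation [X_PAM, L, U_M] is first-order optimal if and only if there exist a permutation σ of {0,…,m−1} and signs ε_0,…,ε_{m−1} ∈ {−1,+1} such that the modified labeling matrix of L satisfies q_{i,k} = ε_k·(−1)^{b_{σ(k)}(i)} for all 0 ≤ i ≤ M−1 and 0 ≤ k ≤ m−1; that is, if and only if L can be derived from the natural binary code by inverting the bits in certain positions and/or permuting the sequence of bits in all codewords. -/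
/-- The `M`-PAM input alphabet: `x_i = 2i + 1 - M`. -/
noncomputable def xpam (m i : ℕ) : ℝ := 2 * (i : ℝ) + 1 - 2^m

lemma pow_perm {m : ℕ} (v : Fin m → ℕ) (e : Finset (Fin m) ≃ Fin (2^m))
    (h : ∀ S, ∑ k ∈ S, v k = (e S : ℕ)) :
    ∃ σ : Equiv.Perm (Fin m), ∀ k, v k = 2 ^ (σ k : ℕ) := by
  classical
  have inj : ∀ S T : Finset (Fin m), ∑ k ∈ S, v k = ∑ k ∈ T, v k → S = T := by
    intro S T hST
    rw [h, h] at hST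
    exact e.injective (Fin.ext hST)
  have key : ∀ j ≤ m, ∃ T : Finset (Fin m), (∀ i < j, ∃ k ∈ T, v k = 2 ^ i) ∧
      (∑ k ∈ T, v k < 2 ^ j) ∧ (∀ n < 2 ^ j, ∃ S ⊆ T, ∑ k ∈ S, v k = n) := by
    intro j
    induction j with
    | zero =>
      intro _
      refine ⟨∅, by simp, by simp, ?_⟩
      intro n hn
      exact ⟨∅, by simp, by simp at hn ⊢; omega⟩
    | succ j ih =>
      intro hj
      obtain ⟨T, h1, h2, h3⟩ := ih (by omega)
      have hlt : 2 ^ j < 2 ^ m := Nat.pow_lt_pow_right (by norm_num) (by omega)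
      have hS : ∑ k ∈ e.symm ⟨2 ^ j, hlt⟩, v k = 2 ^ j := by rw [h]; simp
      set S := e.symm ⟨2 ^ j, hlt⟩
      have : ¬ S ⊆ T := by
        intro hST
        have := Finset.sum_le_sum_of_subset (f := v) hST
        omega
      obtain ⟨k, hkS, hkT⟩ := Finset.not_subset.1 this
      have hk : v k ≤ 2 ^ j := by
        rw [← hS]
        exact Finset.single_le_sum (f := v) (fun _ _ => Nat.zero_le _) hkS
      have hk' : v k = 2 ^ j := by
        by_contra hne
        obtain ⟨R, hR, hRs⟩ := h3 (v k) (by omega)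
        have := inj R {k} (by simpa using hRs)
        apply hkT
        apply hR
        simp [this]
      refine ⟨insert k T, ?_, ?_, ?_⟩
      · intro i hi
        rcases Nat.lt_succ_iff_lt_or_eq.1 hi with hi | rfl
        · obtain ⟨a, ha, hb⟩ := h1 i hi
          exact ⟨a, by simp [ha], hb⟩
        · exact ⟨k, by simp, hk'⟩
      · rw [Finset.sum_insert hkT, pow_succ]; omega
      · intro n hn
        by_cases hnj : n < 2 ^ j
        · obtain ⟨R, hR, hRs⟩ := h3 n hnj
          exact ⟨R, hR.trans (Finset.subset_insert _ _), hRs⟩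
        · rw [pow_succ] at hn
          obtain ⟨R, hR, hRs⟩ := h3 (n - 2 ^ j) (by omega)
          refine ⟨insert k R, Finset.insert_subset_insert _ hR, ?_⟩
          rw [Finset.sum_insert (fun hh => hkT (hR hh))]
          omega
  obtain ⟨T, hT, -⟩ := key m le_rfl
  have : ∀ i : Fin m, ∃ k, v k = 2 ^ (i : ℕ) := fun i => by
    obtain ⟨k, -, hk⟩ := hT i i.2
    exact ⟨k, hk⟩
  choose g hg using this
  have ginj : Function.Injective g := by
    intro a b hab
    have := hg a
    rw [hab, hg b] at this
    exact Fin.ext (Nat.pow_right_injective le_rfl this).symm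
  let G := Equiv.ofBijective g (Finite.injective_iff_bijective.1 ginj)
  refine ⟨G.symm, fun k => ?_⟩
  have := hg (G.symm k)
  rw [← this]
  congr 1
  exact (G.apply_symm_apply k).symm

def sg (b : Bool) : ℝ := if b then -1 else 1

lemma sg_mul_self (b : Bool) : sg b * sg b = 1 := by cases b <;> simp [sg]

lemma orth {m : ℕ} (k l : Fin m) :
    ∑ g : Fin m → Bool, sg (g k) * sg (g l) = if k = l then (2:ℝ)^m else 0 := by
  classical
  split_ifs with h
  · subst h
    simp [sg_mul_self]
  · let φ : (Fin m → Bool) → (Fin m → Bool) := fun g => Function.update g k (!g k)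
    have hφ : Function.Involutive φ := by
      intro g; simp [φ]
    have hsum := Equiv.sum_comp (Function.Involutive.toPerm φ hφ)
      (fun g : Fin m → Bool => sg (g k) * sg (g l))
    have h2 : ∀ g, sg (φ g k) * sg (φ g l) = - (sg (g k) * sg (g l)) := by
      intro g
      have : l ≠ k := fun h' => h h'.symm
      simp only [φ, Function.update_self, Function.update_of_ne this]
      cases g k <;> cases g l <;> simp [sg]
    simp only [Function.Involutive.coe_toPerm, h2, Finset.sum_neg_distrib] at hsum
    linarith

/-- Bessel equality. -/
lemma bessel {m : ℕ} (E : Fin (2^m) ≃ (Fin m → Bool)) (x : Fin (2^m) → ℝ) :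
    (∑ k, ((2^m : ℝ)⁻¹ * ∑ i, sg (E i k) * x i)^2 = (2^m : ℝ)⁻¹ * ∑ i, x i ^ 2) ↔
    ∃ b : Fin m → ℝ, ∀ i, x i = ∑ k, b k * sg (E i k) := by
  have ho : ∀ k l, ∑ i, sg (E i k) * sg (E i l) = if k = l then (2:ℝ)^m else 0 := by
    intro k l
    rw [← orth k l]
    exact Equiv.sum_comp E (fun g => sg (g k) * sg (g l))
  have hM : (2:ℝ)^m ≠ 0 := by positivity
  have hsq : ∀ b : Fin m → ℝ, ∑ i, (∑ k, b k * sg (E i k))^2 = 2^m * ∑ k, b k ^ 2 := by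
    intro b
    simp only [sq, Finset.sum_mul_sum]
    rw [Finset.sum_comm]
    have : ∀ k, ∑ i, ∑ l, b k * sg (E i k) * (b l * sg (E i l)) = 2^m * (b k * b k) := by
      intro k
      rw [Finset.sum_comm]
      have : ∀ l, ∑ i, b k * sg (E i k) * (b l * sg (E i l))
          = if k = l then b k * b l * (2:ℝ)^m else 0 := by
        intro l
        rw [← mul_ite_zero, ← ho k l, Finset.mul_sum]
        exact Finset.sum_congr rfl fun i _ => by ring
      simp only [this]
      simp
      ring
    simp only [this, Finset.mul_sum]
  constructor
  · intro h
    set a : Fin m → ℝ := fun k => (2^m : ℝ)⁻¹ * ∑ i, sg (E i k) * x i with ha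
    refine ⟨a, ?_⟩
    have hcross : ∑ i, x i * ∑ k, a k * sg (E i k) = 2^m * ∑ k, a k ^ 2 := by
      simp only [Finset.mul_sum]
      rw [Finset.sum_comm]
      refine Finset.sum_congr rfl fun k _ => ?_
      have : ∑ i, sg (E i k) * x i = 2^m * a k := by
        simp only [ha]; field_simp
      calc _ = a k * ∑ i, sg (E i k) * x i := by
            rw [Finset.mul_sum]
            exact Finset.sum_congr rfl fun i _ => by ring
        _ = _ := by rw [this]; ring
    have h' : ∑ k, a k ^ 2 = (2^m : ℝ)⁻¹ * ∑ i, x i ^ 2 := h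
    have hz : ∑ i, (x i - ∑ k, a k * sg (E i k))^2 = 0 := by
      have : ∀ i, (x i - ∑ k, a k * sg (E i k))^2 = x i ^ 2 -
        2 * (x i * ∑ k, a k * sg (E i k)) + (∑ k, a k * sg (E i k))^2 := fun i => by ring
      simp only [this, Finset.sum_add_distrib, Finset.sum_sub_distrib, ← Finset.mul_sum]
      rw [hcross, hsq, h']
      field_simp
      ring
    rw [Finset.sum_eq_zero_iff_of_nonneg (fun i _ => sq_nonneg _)] at hz
    intro i
    have := hz i (Finset.mem_univ i)
    have := pow_eq_zero_iff (two_ne_zero) |>.1 this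
    linarith
  · rintro ⟨b, hb⟩
    have : ∀ k, (2^m : ℝ)⁻¹ * ∑ i, sg (E i k) * x i = b k := by
      intro k
      have : ∑ i, sg (E i k) * x i = 2^m * b k := by
        simp only [hb, Finset.mul_sum]
        rw [Finset.sum_comm]
        have : ∀ l, ∑ i, sg (E i k) * (b l * sg (E i l)) = if k = l then b l * (2:ℝ)^m else 0 := by
          intro l
          rw [← mul_ite_zero, ← ho k l, Finset.mul_sum]
          exact Finset.sum_congr rfl fun i _ => by ring
        simp only [this]
        simp
        ring
      rw [this]; field_simp
    simp only [this]
    simp only [hb, hsq]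
    field_simp

lemma nbc_sum {m : ℕ} (i : ℕ) (hi : i < 2^m) :
    xpam m i = ∑ k : Fin m, -(2:ℝ)^(k:ℕ) * sg (Nat.testBit i k) := by
  have h1 : (i:ℝ) = ∑ k ∈ Finset.range m, if Nat.testBit i k then (2:ℝ)^k else 0 := by
    rw [← Finset.sum_filter]
    have h : Finset.filter (fun k => Nat.testBit i k = true) (Finset.range m)
        = i.bitIndices.toFinset := by
      ext k
      simp only [Finset.mem_filter, Finset.mem_range, List.mem_toFinset, Nat.mem_bitIndices]
      constructor
      · exact fun h => h.2
      · intro h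
        refine ⟨?_, h⟩
        by_contra hk
        have : 2^m ≤ 2^k := Nat.pow_le_pow_right (by norm_num) (by omega)
        have := Nat.testBit_lt_two_pow (x := i) (i := k) (by omega)
        simp_all
    rw [h]
    have := Finset.sum_toFinset_bitIndices_two_pow i
    exact_mod_cast this.symm
  have h2 : ∑ k ∈ Finset.range m, (2:ℝ)^k = 2^m - 1 := by
    rw [geom_sum_eq (by norm_num)]; norm_num
  rw [Fin.sum_univ_eq_sum_range (fun k => -(2:ℝ)^k * sg (Nat.testBit i k))]
  have h3 : ∀ k, -(2:ℝ)^k * sg (Nat.testBit i k)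
      = 2 * (if Nat.testBit i k then (2:ℝ)^k else 0) - 2^k := by
    intro k
    cases Nat.testBit i k <;> simp [sg]
    ring
  simp only [h3, Finset.sum_sub_distrib, ← Finset.mul_sum]
  rw [← h1, h2, xpam]; ring

lemma core {m : ℕ} (E : Fin (2^m) ≃ (Fin m → Bool)) :
    (∃ b : Fin m → ℝ, ∀ i : Fin (2^m), xpam m i = ∑ k, b k * sg (E i k)) ↔
    ∃ σ : Equiv.Perm (Fin m), ∃ ε : Fin m → ℝ,
      (∀ k, ε k = 1 ∨ ε k = -1) ∧ ∀ (i : Fin (2^m)) (k : Fin m),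
        sg (E i k) = ε k * sg (Nat.testBit i (σ k : ℕ)) := by
  classical
  constructor
  · rintro ⟨b, hb⟩
    let s : Fin m → Bool := fun k => decide (b k < 0)
    let F : Fin (2^m) → Finset (Fin m) := fun i => Finset.univ.filter fun k => E i k = s k
    have hF : ∀ i k, k ∈ F i ↔ E i k = s k := by intro i k; simp [F]
    have Finj : Function.Injective F := by
      intro i j hij
      apply E.injective
      ext1 k
      have h1 := hF i k
      rw [hij, hF j k] at h1
      revert h1
      cases E i k <;> cases E j k <;> cases s k <;> simp
    have Fbij : Function.Bijective F := by
      rw [Fintype.bijective_iff_injective_and_card]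
      exact ⟨Finj, by simp⟩
    let e := Equiv.ofBijective F Fbij
    set W := ∑ k, |b k| with hW
    have hx : ∀ i : Fin (2^m), xpam m i = 2 * ∑ k ∈ F i, |b k| - W := by
      intro i
      rw [hb i, hW, ← Finset.sum_filter_add_sum_filter_not Finset.univ (fun k => k ∈ F i)
        (fun k => b k * sg (E i k)), ← Finset.sum_filter_add_sum_filter_not Finset.univ
        (fun k => k ∈ F i) (fun k => |b k|)]
      have h1 : ∑ k ∈ Finset.univ.filter (fun k => k ∈ F i), b k * sg (E i k)
          = ∑ k ∈ Finset.univ.filter (fun k => k ∈ F i), |b k| := by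
        refine Finset.sum_congr rfl fun k hk => ?_
        have hk : E i k = s k := (hF i k).1 (by simpa using hk)
        rw [hk]
        by_cases h : b k < 0
        · simp [s, h, sg, abs_of_neg h]
        · simp [s, h, sg, abs_of_nonneg (not_lt.1 h)]
      have h2 : ∑ k ∈ Finset.univ.filter (fun k => ¬ k ∈ F i), b k * sg (E i k)
          = - ∑ k ∈ Finset.univ.filter (fun k => ¬ k ∈ F i), |b k| := by
        rw [← Finset.sum_neg_distrib]
        refine Finset.sum_congr rfl fun k hk => ?_
        have hk : ¬ E i k = s k := fun h => (by simpa using hk : k ∉ F i) ((hF i k).2 h)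
        have hk : E i k = !s k := by revert hk; cases E i k <;> cases s k <;> simp
        rw [hk]
        by_cases h : b k < 0
        · simp [s, h, sg, abs_of_neg h]
        · simp [s, h, sg, abs_of_nonneg (not_lt.1 h)]
      have h3 : Finset.univ.filter (fun k => k ∈ F i) = F i := by ext; simp
      rw [h1, h2, h3]
      ring
    have hWM : W = 2^m - 1 := by
      apply le_antisymm
      · obtain ⟨i, hi⟩ := Fbij.2 ∅
        have := hx i
        rw [hi, xpam] at this
        simp only [Finset.sum_empty] at this
        have : (0:ℝ) ≤ ((i:ℕ):ℝ) := Nat.cast_nonneg _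
        linarith
      · have := hx ⟨0, by positivity⟩
        have h0 : 0 ≤ ∑ k ∈ F ⟨0, by positivity⟩, |b k| :=
          Finset.sum_nonneg fun _ _ => abs_nonneg _
        rw [xpam] at this
        simp only [Nat.cast_zero] at this
        linarith
    have hsum : ∀ i : Fin (2^m), ((i:ℕ):ℝ) = ∑ k ∈ F i, |b k| := by
      intro i
      have := hx i
      rw [xpam, hWM] at this
      linarith
    have hsum' : ∀ S, ∑ k ∈ S, |b k| = ((e.symm S : ℕ) : ℝ) := by
      intro S
      rw [hsum]
      congr 1
      exact (e.apply_symm_apply S).symm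
    let v : Fin m → ℕ := fun k => e.symm {k}
    have hv : ∀ k, |b k| = v k := by
      intro k
      rw [← hsum' {k}]; simp
    obtain ⟨σ, hσ⟩ := pow_perm v e.symm (by
      intro S
      have := hsum' S
      simp only [hv] at this
      exact_mod_cast this)
    have hi : ∀ i : Fin (2^m), (i:ℕ) = ∑ k ∈ F i, 2^(σ k : ℕ) := by
      intro i
      have := hsum i
      simp only [hv, hσ] at this
      exact_mod_cast this
    have htb : ∀ (i : Fin (2^m)) k, Nat.testBit i (σ k : ℕ) = true ↔ E i k = s k := by
      intro i k
      let f : Fin m ↪ ℕ := σ.toEmbedding.trans Fin.valEmbedding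
      have h1 : (i:ℕ) = ∑ j ∈ (F i).map f, 2^j := by
        rw [Finset.sum_map]; exact hi i
      have h2 := Finset.toFinset_bitIndices_sum_two_pow ((F i).map f)
      rw [← h1] at h2
      rw [← Nat.mem_bitIndices, ← List.mem_toFinset, h2, ← hF]
      exact Finset.mem_map' f (a := k)
    refine ⟨σ, fun k => - sg (s k), ?_, ?_⟩
    · intro k
      beta_reduce
      generalize s k = t
      cases t <;> simp [sg]
    · intro i k
      have := htb i k
      revert this
      beta_reduce
      generalize s k = t
      cases Nat.testBit i (σ k : ℕ) <;> cases E i k <;> cases t <;> simp [sg]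
  · rintro ⟨σ, ε, hε, h⟩
    refine ⟨fun k => -(ε k * 2^(σ k : ℕ)), fun i => ?_⟩
    rw [nbc_sum i i.2, ← Equiv.sum_comp σ]
    refine Finset.sum_congr rfl fun k _ => ?_
    rw [h]
    rcases hε k with h' | h' <;> simp only [h'] <;> ring


/-- `[X_PAM, L, U_M]` is first-order optimal iff there are a permutation `σ` of
`{0,…,m-1}` and signs `ε_k ∈ {±1}` with `q_{i,k} = ε_k·(-1)^{b_{σ(k)}(i)}`,
i.e., iff `L` is the NBC up to bit inversions and bit-position permutations. -/
theorem pam_foo_iff_nbc (m : ℕ) (hm : 1 ≤ m)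
    (c : ℕ → ℕ → Bool)
    (hc : ∀ i < 2^m, ∀ j < 2^m, (∀ k < m, c i k = c j k) → i = j) :
    (Real.logb 2 (Real.exp 1) /
        ((2^m : ℝ)⁻¹ * ∑ i ∈ Finset.range (2^m), xpam m i ^ 2)) *
      ∑ k ∈ Finset.range m,
        ((2^m : ℝ)⁻¹ * ∑ i ∈ Finset.range (2^m), Qmat m c i k * xpam m i)^2
      = Real.logb 2 (Real.exp 1)
    ↔ ∃ σ : Equiv.Perm (Fin m), ∃ ε : Fin m → ℝ,
        (∀ k, ε k = 1 ∨ ε k = -1) ∧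
        ∀ i < 2^m, ∀ k : Fin m,
          Qmat m c i (k : ℕ)
            = ε k * (if Nat.testBit i ((σ k : Fin m) : ℕ) then (-1:ℝ) else 1) := by
  classical
  have hEinj : Function.Injective
      (fun (i : Fin (2^m)) (k : Fin m) => c i (m - 1 - (k:ℕ))) := by
    intro i j hij
    apply Fin.ext
    apply hc i i.2 j j.2
    intro k hk
    have := congrFun hij ⟨m - 1 - k, by omega⟩
    have hk' : m - 1 - (m - 1 - k) = k := by omega
    simpa [hk'] using this
  let E : Fin (2^m) ≃ (Fin m → Bool) := Equiv.ofBijective _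
    ((Fintype.bijective_iff_injective_and_card _).2 ⟨hEinj, by simp⟩)
  have hE : ∀ (i : Fin (2^m)) (k : Fin m), Qmat m c i k = sg (E i k) := fun i k => rfl
  have hL : Real.logb 2 (Real.exp 1) ≠ 0 := by
    have : 0 < Real.logb 2 (Real.exp 1) :=
      Real.logb_pos (by norm_num) (Real.one_lt_exp_iff.2 one_pos)
    exact this.ne'
  have hX : (2^m : ℝ)⁻¹ * ∑ i ∈ Finset.range (2^m), xpam m i ^ 2 ≠ 0 := by
    have h0 : xpam m 0 ^ 2 ≤ ∑ i ∈ Finset.range (2^m), xpam m i ^ 2 :=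
      Finset.single_le_sum (f := fun i => xpam m i ^ 2) (fun i _ => sq_nonneg _) (by simp)
    have h1 : (2:ℝ) ≤ 2^m := by
      calc (2:ℝ) = 2^1 := by norm_num
        _ ≤ 2^m := pow_le_pow_right₀ (by norm_num) hm
    have h2 : 0 < xpam m 0 ^ 2 := by
      have : xpam m 0 ≠ 0 := by
        rw [xpam]; simp only [Nat.cast_zero]; linarith
      positivity
    have : 0 < ∑ i ∈ Finset.range (2^m), xpam m i ^ 2 := by linarith
    positivity
  have hfoo : ∀ L X Y : ℝ, L ≠ 0 → X ≠ 0 → (L / X * Y = L ↔ Y = X) := by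
    intro L X Y hL hX
    rw [div_mul_eq_mul_div, div_eq_iff hX]
    exact mul_right_inj' hL
  rw [hfoo _ _ _ hL hX]
  rw [Finset.sum_range, Finset.sum_range]
  simp only [Finset.sum_range, hE]
  rw [bessel E (fun i => xpam m i), core E]
  refine exists_congr fun σ => exists_congr fun ε => and_congr_right fun _ => ?_
  constructor
  · intro h i hi k
    exact h ⟨i, hi⟩ k
  · intro h i k
    exact h i i.2 k
end

section
/- Let m ≥ 1, M = 2^m, L a binary labeling of order m, and X an M×N real input alphabet with M distinct rows all having the same Euclidean norm ‖x_i‖² = E > 0. If the constellation [X, L, U_M] is first-order optimal, then M ≤ 2^N (equivalently m ≤ N); i.e., first-order optimal constellations based on constant-energy input alphabets in N dimensions cannot have more than 2^N points. -/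
/-- Sign of a bit. -/
def sgB (b : Bool) : ℝ := if b then -1 else 1

lemma sgB_not (b : Bool) : sgB (!b) = - sgB b := by cases b <;> simp [sgB]

lemma sgB_sq (b : Bool) : sgB b * sgB b = 1 := by cases b <;> simp [sgB]

/-- Flip one bit. -/
def flipB {m : ℕ} (k : Fin m) (s : Fin m → Bool) : Fin m → Bool :=
  Function.update s k (!(s k))

lemma flipB_flipB {m : ℕ} (k : Fin m) : Function.Involutive (flipB k) := by
  intro s
  simp [flipB]

lemma sum_sgB {m : ℕ} (k l : Fin m) :
    ∑ s : Fin m → Bool, sgB (s k) * sgB (s l) = if k = l then (2 ^ m : ℝ) else 0 := by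
  split_ifs with h
  · subst h
    simp [sgB_sq]
  · have h1 := (flipB_flipB k).toPerm.sum_comp (M := ℝ) Finset.univ
      (fun s => sgB (s k) * sgB (s l)) (by simp)
    have h2 : ∀ s : Fin m → Bool, sgB (flipB k s k) * sgB (flipB k s l)
        = - (sgB (s k) * sgB (s l)) := by
      intro s
      have : flipB k s l = s l := by simp [flipB, Function.update_of_ne (Ne.symm h)]
      rw [this]
      simp [flipB, sgB_not]
    simp only [Function.Involutive.coe_toPerm, h2, Finset.sum_neg_distrib] at h1
    linarith

lemma foo_core {V : Type*} [NormedAddCommGroup V] [InnerProductSpace ℝ V]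
    [FiniteDimensional ℝ V] (m : ℕ) (X : (Fin m → Bool) → V) (hX : Function.Injective X)
    (E : ℝ) (hn : ∀ s, ‖X s‖ ^ 2 = E) (y : Fin m → V)
    (hy : ∀ k, y k = (2 ^ m : ℝ)⁻¹ • ∑ s, sgB (s k) • X s)
    (hE : ∑ k, ‖y k‖ ^ 2 = E) : m ≤ Module.finrank ℝ V := by
  have hM : (2 ^ m : ℝ) ≠ 0 := by positivity
  have hy' : ∀ k, ∑ s, sgB (s k) • X s = (2 ^ m : ℝ) • y k := by
    intro k
    rw [hy, smul_smul, mul_inv_cancel₀ hM, one_smul]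
  have hsum : ∑ s, ‖X s - ∑ k, sgB (s k) • y k‖ ^ 2 = 0 := by
    have e1 : ∑ s, ‖X s‖ ^ 2 = 2 ^ m * E := by simp [hn]
    have e2 : ∑ s, inner ℝ (X s) (∑ k, sgB (s k) • y k) = 2 ^ m * E := by
      simp only [inner_sum, inner_smul_right]
      rw [Finset.sum_comm, ← hE, Finset.mul_sum]
      refine Finset.sum_congr rfl fun k _ => ?_
      have := congrArg (fun v => inner ℝ v (y k)) (hy' k)
      simp only [sum_inner, real_inner_smul_left, real_inner_self_eq_norm_sq] at this
      exact this
    have e3 : ∑ s : Fin m → Bool, ‖∑ k, sgB (s k) • y k‖ ^ 2 = 2 ^ m * E := by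
      simp only [← real_inner_self_eq_norm_sq, inner_sum, sum_inner, inner_smul_right,
        real_inner_smul_left]
      rw [Finset.sum_comm, ← hE, Finset.mul_sum]
      refine Finset.sum_congr rfl fun k _ => ?_
      simp only [Finset.mul_sum]
      rw [Finset.sum_comm]
      simp only [← mul_assoc, ← Finset.sum_mul, sum_sgB]
      simp
    simp only [norm_sub_sq_real, Finset.sum_add_distrib, Finset.sum_sub_distrib,
      ← Finset.mul_sum, e1, e2, e3]
    ring
  have hrep : ∀ s, X s = ∑ k, sgB (s k) • y k := by
    intro s
    have := (Finset.sum_eq_zero_iff_of_nonneg (fun s _ => by positivity)).1 hsum s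
      (Finset.mem_univ s)
    exact sub_eq_zero.1 (norm_eq_zero.1 (pow_eq_zero_iff two_ne_zero |>.1 this))
  have hflip : ∀ s k, X (flipB k s) = X s - (2 * sgB (s k)) • y k := by
    intro s k
    rw [hrep, hrep s, eq_sub_iff_add_eq, ← Finset.add_sum_erase _ _ (Finset.mem_univ k),
      ← Finset.add_sum_erase (a := k) (f := fun j => sgB (s j) • y j) _ (Finset.mem_univ k)]
    have : ∑ j ∈ Finset.univ.erase k, sgB (flipB k s j) • y j
        = ∑ j ∈ Finset.univ.erase k, sgB (s j) • y j := by
      refine Finset.sum_congr rfl fun j hj => ?_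
      simp [flipB, Function.update_of_ne (Finset.ne_of_mem_erase hj)]
    rw [this]
    simp only [flipB, Function.update_self, sgB_not]
    module
  have hin : ∀ s k, sgB (s k) * inner ℝ (X s) (y k) = ‖y k‖ ^ 2 := by
    intro s k
    have h := hn (flipB k s)
    rw [hflip, norm_sub_sq_real, hn, inner_smul_right, norm_smul, mul_pow, Real.norm_eq_abs,
      sq_abs] at h
    nlinarith [sgB_sq (s k)]
  have hne : ∀ k, y k ≠ 0 := by
    intro k h0
    have h := hflip (fun _ => false) k
    rw [h0, smul_zero, sub_zero] at h
    have := congrFun (hX h) k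
    simp [flipB] at this
  have horth : Pairwise fun k l => inner ℝ (y k) (y l) = 0 := by
    intro l k hlk
    have h1 := hin (fun _ => false) k
    have h2 := hin (flipB l (fun _ => false)) k
    rw [hflip, inner_sub_left, real_inner_smul_left] at h2
    simp [flipB, Function.update_of_ne (Ne.symm hlk), sgB] at h1 h2
    linarith
  have := (linearIndependent_of_ne_zero_of_inner_eq_zero hne horth).fintype_card_le_finrank
  simpa using this

/-- First-order optimal constellations based on constant-energy input alphabets in
`N` dimensions cannot have more than `2^N` points: if `[X, L, U_M]` is FOO with `M`
distinct constant-energy symbols, then `M = 2^m ≤ 2^N`. -/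
theorem constant_energy_foo_card_le (m N : ℕ) (hm : 1 ≤ m)
    (c : ℕ → ℕ → Bool)
    (hc : ∀ i < 2^m, ∀ j < 2^m, (∀ k < m, c i k = c j k) → i = j)
    (x : ℕ → EuclideanSpace ℝ (Fin N)) (E : ℝ) (hE : 0 < E)
    (hconst : ∀ i < 2^m, ‖x i‖^2 = E)
    (hdist : ∀ i < 2^m, ∀ j < 2^m, x i = x j → i = j)
    (hfoo : (Real.logb 2 (Real.exp 1) /
        ((2^m : ℝ)⁻¹ * ∑ i ∈ Finset.range (2^m), ‖x i‖^2)) *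
      ∑ k ∈ Finset.range m,
        ‖(2^m : ℝ)⁻¹ • ∑ i ∈ Finset.range (2^m), Qmat m c i k • x i‖^2
      = Real.logb 2 (Real.exp 1)) :
    2^m ≤ 2^N := by
  have hl : Real.logb 2 (Real.exp 1) ≠ 0 :=
    (Real.logb_pos (by norm_num) (Real.one_lt_exp_iff.2 one_pos)).ne'
  have hM : (2 ^ m : ℝ) ≠ 0 := by positivity
  have hEs : (2^m : ℝ)⁻¹ * ∑ i ∈ Finset.range (2^m), ‖x i‖^2 = E := by
    rw [Finset.sum_congr rfl fun i hi => hconst i (Finset.mem_range.1 hi)]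
    simp
  rw [hEs] at hfoo
  have hfoo' : ∑ k ∈ Finset.range m,
      ‖(2^m : ℝ)⁻¹ • ∑ i ∈ Finset.range (2^m), Qmat m c i k • x i‖^2 = E := by
    field_simp at hfoo
    simpa [div_eq_iff hE.ne'] using hfoo
  let f : Fin (2 ^ m) → (Fin m → Bool) := fun i k => c i (m - 1 - k)
  have hf : Function.Bijective f := by
    rw [Fintype.bijective_iff_injective_and_card]
    refine ⟨fun i j h => Fin.ext (hc i i.2 j j.2 fun k hk => ?_), by simp⟩
    have := congrFun h ⟨m - 1 - k, by omega⟩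
    have e : m - 1 - (m - 1 - k) = k := by omega
    simpa [f, e] using this
  let e := Equiv.ofBijective f hf
  refine Nat.pow_le_pow_right (by norm_num) ?_
  have key := foo_core m (fun s => x (e.symm s)) ?_ E (fun s => hconst _ (e.symm s).2)
    (fun k => (2 ^ m : ℝ)⁻¹ • ∑ s, sgB (s k) • x (e.symm s)) (fun k => rfl) ?_
  · simpa using key
  · intro s t h
    exact e.symm.injective (Fin.ext (hdist _ (e.symm s).2 _ (e.symm t).2 h))
  · rw [← hfoo', Finset.sum_range]
    refine Finset.sum_congr rfl fun k _ => ?_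
    rw [Finset.sum_range, ← e.sum_comp]
    simp only [Equiv.symm_apply_apply]
    rfl
end

section
/- Let m ≥ 3 and M = 2^m (so M > 4), and let X_PSK be the M-PSK input alphabet. Then for every binary labeling L of order m, the constellation [X_PSK, L, U_M] is not first-order optimal: α(X_PSK, L) < log₂ e. -/
/-- The `M`-PSK input alphabet: `x_i = (cos((2i+1)π/M), sin((2i+1)π/M))`. -/
noncomputable def xpsk (m i : ℕ) : EuclideanSpace ℝ (Fin 2) :=
  (WithLp.equiv 2 (Fin 2 → ℝ)).symm
    ![Real.cos ((2 * (i:ℝ) + 1) * Real.pi / 2^m),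
      Real.sin ((2 * (i:ℝ) + 1) * Real.pi / 2^m)]

/-- The sign of a bit. -/
def sgnb (b : Bool) : ℝ := if b then -1 else 1

lemma sgnb_mul_self (b : Bool) : sgnb b * sgnb b = 1 := by cases b <;> simp [sgnb]

lemma sgnb_not (b : Bool) : sgnb (!b) = - sgnb b := by cases b <;> simp [sgnb]

lemma sgnb_ne (b : Bool) : sgnb b ≠ 0 := by cases b <;> simp [sgnb]

/-- Flip the `k`-th bit. -/
def flipb {m : ℕ} (k : Fin m) (s : Fin m → Bool) : Fin m → Bool := Function.update s k (!s k)

lemma flipb_same {m : ℕ} (k : Fin m) (s : Fin m → Bool) : flipb k s k = !s k := by simp [flipb]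

lemma flipb_ne {m : ℕ} (k l : Fin m) (h : l ≠ k) (s : Fin m → Bool) : flipb k s l = s l := by
  simp [flipb, h]

lemma flipb_flipb {m : ℕ} (k : Fin m) (s : Fin m → Bool) : flipb k (flipb k s) = s := by
  simp [flipb]

lemma flipb_ne_self {m : ℕ} (k : Fin m) (s : Fin m → Bool) : flipb k s ≠ s := by
  intro h
  have := congrFun h k
  rw [flipb_same] at this
  cases h : s k <;> simp [h] at this

lemma sum_sgnb {m : ℕ} (k l : Fin m) :
    ∑ s : Fin m → Bool, sgnb (s k) * sgnb (s l) = if k = l then (2 : ℝ) ^ m else 0 := by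
  split_ifs with h
  · subst h
    simp [sgnb_mul_self]
  · refine Finset.sum_involution (fun s _ => flipb k s) ?_ ?_ ?_ ?_
    · intro s _
      rw [flipb_same, flipb_ne k l (Ne.symm h), sgnb_not]; ring
    · intro s _ _
      exact flipb_ne_self k s
    · simp
    · intro s _
      exact flipb_flipb k s

lemma key {m : ℕ} (hm : 3 ≤ m) (y : (Fin m → Bool) → EuclideanSpace ℝ (Fin 2))
    (hinj : Function.Injective y) (hn : ∀ s, ‖y s‖ = 1) :
    ∑ k : Fin m, ‖(2 ^ m : ℝ)⁻¹ • ∑ s, sgnb (s k) • y s‖ ^ 2 < 1 := by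
  set a : Fin m → EuclideanSpace ℝ (Fin 2) :=
    fun k => (2 ^ m : ℝ)⁻¹ • ∑ s, sgnb (s k) • y s with ha
  set f : (Fin m → Bool) → EuclideanSpace ℝ (Fin 2) := fun s => ∑ k, sgnb (s k) • a k with hf
  have hM : (0 : ℝ) < 2 ^ m := by positivity
  have hsum : ∀ k, ∑ s, sgnb (s k) • y s = (2 ^ m : ℝ) • a k := by
    intro k
    simp only [ha]
    rw [smul_smul, mul_inv_cancel₀ hM.ne', one_smul]
  have h1 : ∑ s, inner ℝ (y s) (f s) = 2 ^ m * ∑ k, ‖a k‖ ^ 2 := by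
    simp only [hf, inner_sum, inner_smul_right]
    rw [Finset.sum_comm, Finset.mul_sum]
    refine Finset.sum_congr rfl fun k _ => ?_
    have : ∑ s, sgnb (s k) * inner ℝ (y s) (a k) = inner ℝ (∑ s, sgnb (s k) • y s) (a k) := by
      simp [sum_inner, inner_smul_left]
    rw [this, hsum, inner_smul_left, real_inner_self_eq_norm_sq]
    simp
  have h2 : ∑ s, ‖f s‖ ^ 2 = 2 ^ m * ∑ k, ‖a k‖ ^ 2 := by
    have : ∀ s, ‖f s‖ ^ 2 = ∑ k, ∑ l, (sgnb (s k) * sgnb (s l)) * inner ℝ (a k) (a l) := by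
      intro s
      rw [← real_inner_self_eq_norm_sq]
      simp only [hf, inner_sum, sum_inner, inner_smul_right, inner_smul_left,
        Finset.mul_sum]
      rw [Finset.sum_comm]
      refine Finset.sum_congr rfl fun k _ => Finset.sum_congr rfl fun l _ => ?_
      simp; ring
    simp only [this]
    rw [Finset.sum_comm, Finset.mul_sum]
    refine Finset.sum_congr rfl fun k _ => ?_
    rw [Finset.sum_comm]
    simp only [← Finset.sum_mul, sum_sgnb]
    simp
  have h3 : ∑ s, ‖y s - f s‖ ^ 2 = 2 ^ m * (1 - ∑ k, ‖a k‖ ^ 2) := by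
    simp only [norm_sub_sq_real, hn, Finset.sum_add_distrib, Finset.sum_sub_distrib,
      ← Finset.mul_sum, h1, h2]
    simp
    ring
  by_contra hcon
  have hcon' : 1 ≤ ∑ k, ‖a k‖ ^ 2 := not_lt.mp hcon
  have h4 : ∑ s, ‖y s - f s‖ ^ 2 = 0 := by
    apply le_antisymm
    · rw [h3]; nlinarith
    · positivity
  have hyf : ∀ s, y s = f s := by
    intro s
    have := (Finset.sum_eq_zero_iff_of_nonneg (fun s _ => by positivity)).mp h4 s (Finset.mem_univ s)
    exact sub_eq_zero.mp (by simpa using this)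
  have hflip : ∀ k s, f (flipb k s) = f s - (2 * sgnb (s k)) • a k := by
    intro k s
    simp only [hf]
    rw [← Finset.add_sum_erase _ _ (Finset.mem_univ k),
      ← Finset.add_sum_erase Finset.univ (fun j => sgnb (s j) • a j) (Finset.mem_univ k)]
    have : ∑ x ∈ Finset.univ.erase k, sgnb (flipb k s x) • a x
        = ∑ x ∈ Finset.univ.erase k, sgnb (s x) • a x :=
      Finset.sum_congr rfl fun l hl => by rw [flipb_ne k l (Finset.ne_of_mem_erase hl)]
    rw [this, flipb_same, sgnb_not]
    module
  have hne : ∀ k, a k ≠ 0 := by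
    intro k hk
    have := hflip k (fun _ => false)
    rw [hk, smul_zero, sub_zero, ← hyf, ← hyf] at this
    exact flipb_ne_self k _ (hinj this)
  have hin : ∀ k s, inner ℝ (f s) (a k) = sgnb (s k) * ‖a k‖ ^ 2 := by
    intro k s
    have e1 : ‖f (flipb k s)‖ ^ 2 = 1 := by rw [← hyf, hn]; norm_num
    have e2 : ‖f s‖ ^ 2 = 1 := by rw [← hyf, hn]; norm_num
    rw [hflip, norm_sub_sq_real, e2, inner_smul_right, norm_smul, mul_pow, Real.norm_eq_abs,
      sq_abs] at e1
    have e3 := sgnb_mul_self (s k)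
    have e4 : sgnb (s k) * (inner ℝ (f s) (a k) - sgnb (s k) * ‖a k‖ ^ 2) = 0 := by
      linear_combination (-1/4) * e1
    rcases mul_eq_zero.mp e4 with h | h
    · exact absurd h (sgnb_ne _)
    · linarith
  have horth : ∀ k l, k ≠ l → inner ℝ (a k) (a l) = 0 := by
    intro k l hkl
    have e1 := hin l (flipb k (fun _ => false))
    rw [hflip, flipb_ne k l hkl.symm, inner_sub_left, hin, inner_smul_left] at e1
    simpa [sgnb] using e1
  have hli := linearIndependent_of_ne_zero_of_inner_eq_zero (𝕜 := ℝ) hne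
    (fun k l hkl => horth k l hkl)
  have := hli.fintype_card_le_finrank
  simp at this
  omega

lemma xpsk_norm (m i : ℕ) : ‖xpsk m i‖ = 1 := by
  rw [EuclideanSpace.norm_eq]
  simp [xpsk, Fin.sum_univ_two]

lemma xpsk_inj (m i j : ℕ) (hi : i < 2 ^ m) (hj : j < 2 ^ m) (h : xpsk m i = xpsk m j) :
    i = j := by
  have h0 := congrArg (fun v => v 0) h
  have h1 := congrArg (fun v => v 1) h
  simp [xpsk] at h0 h1
  have h2 := Real.Angle.cos_sin_inj h0 h1
  rw [Real.Angle.angle_eq_iff_two_pi_dvd_sub] at h2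
  obtain ⟨n, hn⟩ := h2
  have hM : (0 : ℝ) < 2 ^ m := by positivity
  have hpi := Real.pi_pos
  have h3 : (i : ℝ) - j = 2 ^ m * n := by
    field_simp at hn
    nlinarith
  have h4 : (i : ℤ) - j = 2 ^ m * n := by exact_mod_cast h3
  have hi' : (i : ℤ) < 2 ^ m := by exact_mod_cast hi
  have hj' : (j : ℤ) < 2 ^ m := by exact_mod_cast hj
  have hn0 : n = 0 := by
    by_contra hn0
    rcases lt_or_gt_of_ne hn0 with h | h
    · nlinarith
    · nlinarith
  subst hn0
  omega

/-- For `M = 2^m > 4`, no constellation based on the `M`-PSK input alphabet is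
first-order optimal, regardless of the binary labeling: `α(X_PSK, L) < log₂ e`. -/
theorem psk_not_foo (m : ℕ) (hm : 3 ≤ m)
    (c : ℕ → ℕ → Bool)
    (hc : ∀ i < 2^m, ∀ j < 2^m, (∀ k < m, c i k = c j k) → i = j) :
    (Real.logb 2 (Real.exp 1) /
        ((2^m : ℝ)⁻¹ * ∑ i ∈ Finset.range (2^m), ‖xpsk m i‖^2)) *
      ∑ k ∈ Finset.range m,
        ‖(2^m : ℝ)⁻¹ • ∑ i ∈ Finset.range (2^m), Qmat m c i k • xpsk m i‖^2
      < Real.logb 2 (Real.exp 1) := by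
  have hlog : 0 < Real.logb 2 (Real.exp 1) :=
    Real.logb_pos (by norm_num) (by simp)
  have hEs : (2^m : ℝ)⁻¹ * ∑ i ∈ Finset.range (2^m), ‖xpsk m i‖^2 = 1 := by
    simp [xpsk_norm]
  rw [hEs, div_one]
  let g : Fin (2 ^ m) → (Fin m → Bool) := fun i k => c i k
  have hg : Function.Injective g := by
    intro i j hij
    apply Fin.ext
    exact hc i i.2 j j.2 fun k hk => congrFun hij ⟨k, hk⟩
  have hb : Function.Bijective g :=
    (Fintype.bijective_iff_injective_and_card g).mpr ⟨hg, by simp⟩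
  let e := Equiv.ofBijective g hb
  have hk := key hm (fun s => xpsk m (e.symm s))
    (fun s t hst => e.symm.injective (Fin.ext (xpsk_inj m _ _ (e.symm s).2 (e.symm t).2 hst)))
    (fun s => xpsk_norm m _)
  have hS : ∑ k ∈ Finset.range m,
        ‖(2^m : ℝ)⁻¹ • ∑ i ∈ Finset.range (2^m), Qmat m c i k • xpsk m i‖^2 =
      ∑ k : Fin m, ‖(2 ^ m : ℝ)⁻¹ • ∑ s, sgnb (s k) • xpsk m (e.symm s)‖ ^ 2 := by
    rw [← Finset.sum_range_reflect, Finset.sum_range]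
    refine Finset.sum_congr rfl fun k _ => ?_
    congr 3
    rw [Finset.sum_range, ← Equiv.sum_comp e]
    refine Finset.sum_congr rfl fun i _ => ?_
    rw [Equiv.symm_apply_apply]
    congr 1
    have : m - 1 - (m - 1 - (k : ℕ)) = k := by omega
    simp only [Qmat, this]
    rfl
  rw [hS]
  nlinarith
end

section
/- Let m ≥ 3, M = 2^m, and let X_PAM be the M-PAM input alphabet, whose average symbol energy is Es = (M²−1)/3. Then the first-order coefficient α(X_PAM, L) of the constellation [X_PAM, L, U_M] equals: (3M²/(4(M²−1)))·log₂ e if L is the binary reflected Gray code G_m or the folded binary code F_m; log₂ e if L is the natural binary code N_m; and 0 if L is the binary semi-Gray code S_m. -/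
/-- Binary reflected Gray code: `c_i` is the `m`-bit representation of `i XOR ⌊i/2⌋`. -/
def brgc (m i k : ℕ) : Bool := Nat.testBit (i ^^^ (i / 2)) (m - 1 - k)

/-- Folded binary code: `c_i = (0, (m-1)-bit rep. of i)` for `i < M/2` and
`c_i = (1, (m-1)-bit rep. of M-1-i)` for `i ≥ M/2`. -/
def fbc (m i k : ℕ) : Bool :=
  if k = 0 then decide (2^(m-1) ≤ i)
  else if i < 2^(m-1) then Nat.testBit i (m - 1 - k)
  else Nat.testBit (2^m - 1 - i) (m - 1 - k)

/-- Binary semi-Gray code: the BRGC with its first column replaced by the mod-2 sum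
of the first and last columns of the BRGC. -/
def bsgc (m i k : ℕ) : Bool :=
  if k = 0 then xor (brgc m i 0) (brgc m i (m - 1)) else brgc m i k

/-- The first-order coefficient `α(X,L) = (log₂ e / Es)·Σ_k ((1/M) Σ_i q_{i,k} x_i)²`
of a one-dimensional constellation with uniform input distribution. -/
noncomputable def alpha1 (m : ℕ) (c : ℕ → ℕ → Bool) (x : ℕ → ℝ) : ℝ :=
  (Real.logb 2 (Real.exp 1) /
      ((2^m : ℝ)⁻¹ * ∑ i ∈ Finset.range (2^m), x i ^ 2)) *
    ∑ k ∈ Finset.range m,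
      ((2^m : ℝ)⁻¹ * ∑ i ∈ Finset.range (2^m), Qmat m c i k * x i)^2

lemma sum_split (n : ℕ) (f : ℕ → ℝ) :
    ∑ i ∈ Finset.range (2 * n), f i = ∑ i ∈ Finset.range n, (f (2 * i) + f (2 * i + 1)) := by
  induction n with
  | zero => simp
  | succ n ih =>
    rw [Finset.sum_range_succ, ← ih, show 2 * (n + 1) = 2 * n + 1 + 1 by ring,
      Finset.sum_range_succ, Finset.sum_range_succ]
    ring

/-- The sign of a bit. -/
noncomputable def bsg (b : Bool) : ℝ := if b then -1 else 1

lemma bsg_not (b : Bool) : bsg (!b) = - bsg b := by cases b <;> simp [bsg]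

lemma tb_even (i k : ℕ) : Nat.testBit (2 * i) (k + 1) = Nat.testBit i k := by
  rw [Nat.testBit_succ]; congr 1; omega

lemma tb_odd (i k : ℕ) : Nat.testBit (2 * i + 1) (k + 1) = Nat.testBit i k := by
  rw [Nat.testBit_succ]; congr 1; omega

lemma sum_bit (m : ℕ) : ∀ k, k < m →
    ∑ i ∈ Finset.range (2 ^ m), bsg (Nat.testBit i k) * xpam m i = - 2 ^ m * 2 ^ k := by
  induction m with
  | zero => intro k hk; omega
  | succ m ih =>
    intro k hk
    rw [show 2 ^ (m + 1) = 2 * 2 ^ m by ring, sum_split]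
    cases k with
    | zero =>
      have : ∀ i ∈ Finset.range (2 ^ m), bsg (Nat.testBit (2 * i) 0) * xpam (m + 1) (2 * i) +
          bsg (Nat.testBit (2 * i + 1) 0) * xpam (m + 1) (2 * i + 1) = -2 := by
        intro i _
        simp [Nat.testBit_zero, bsg, xpam]
        ring
      rw [Finset.sum_congr rfl this]
      simp
      ring
    | succ k =>
      have : ∀ i ∈ Finset.range (2 ^ m),
          bsg (Nat.testBit (2 * i) (k + 1)) * xpam (m + 1) (2 * i) +
          bsg (Nat.testBit (2 * i + 1) (k + 1)) * xpam (m + 1) (2 * i + 1)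
            = 4 * (bsg (Nat.testBit i k) * xpam m i) := by
        intro i _
        rw [tb_even, tb_odd]
        simp only [xpam]
        push_cast
        ring
      rw [Finset.sum_congr rfl this, ← Finset.mul_sum, ih k (by omega)]
      ring

lemma sum_three (m : ℕ) :
    ∑ i ∈ Finset.range (2 ^ (m + 3)),
      bsg (xor (Nat.testBit i (m + 2)) (xor (Nat.testBit i 0) (Nat.testBit i 1)))
        * xpam (m + 3) i = 0 := by
  rw [show 2 ^ (m + 3) = 2 * (2 * 2 ^ (m + 1)) by ring, sum_split, sum_split]
  apply Finset.sum_eq_zero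
  intro i _
  have h1 (j : ℕ) : Nat.testBit (2 * j) 1 = Nat.testBit j 0 := tb_even j 0
  have h2 (j : ℕ) : Nat.testBit (2 * j + 1) 1 = Nat.testBit j 0 := tb_odd j 0
  have e0 (j : ℕ) : Nat.testBit (2 * j) 0 = false := by simp [Nat.testBit_zero]
  have o0 (j : ℕ) : Nat.testBit (2 * j + 1) 0 = true := by simp [Nat.testBit_zero]
  simp only [h1, h2, e0, o0, tb_even, tb_odd]
  cases Nat.testBit i m <;> simp [bsg, xpam] <;> ring

lemma sum_refl (m : ℕ) (f : ℕ → ℝ) (h : ∀ i, i < 2 ^ m → f (2 ^ m - 1 - i) = f i) :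
    ∑ i ∈ Finset.range (2 ^ m), f i * xpam m i = 0 := by
  have key : ∑ i ∈ Finset.range (2 ^ m), f i * xpam m i
      = ∑ i ∈ Finset.range (2 ^ m), - (f i * xpam m i) := by
    rw [← Finset.sum_range_reflect]
    apply Finset.sum_congr rfl
    intro i hi
    have hi' := Finset.mem_range.mp hi
    rw [h i hi']
    have : ((2 ^ m - 1 - i : ℕ) : ℝ) = 2 ^ m - 1 - i := by
      have h3 : (2 ^ m - 1 - i) + 1 + i = 2 ^ m := by omega
      have h4 : (((2 ^ m - 1 - i) + 1 + i : ℕ) : ℝ) = ((2 ^ m : ℕ) : ℝ) := by rw [h3]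
      push_cast at h4
      linarith
    simp only [xpam, this]
    ring
  rw [Finset.sum_neg_distrib] at key
  linarith

lemma tb_refl (m i k : ℕ) (hi : i < 2 ^ m) (hk : k < m) :
    Nat.testBit (2 ^ m - 1 - i) k = !Nat.testBit i k := by
  rw [show 2 ^ m - 1 - i = 2 ^ m - (i + 1) by omega, Nat.testBit_two_pow_sub_succ hi]
  simp [hk]

lemma gray_tb (i k : ℕ) :
    Nat.testBit (i ^^^ (i / 2)) k = xor (Nat.testBit i k) (Nat.testBit i (k + 1)) := by
  rw [Nat.testBit_xor, Nat.testBit_succ]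

lemma gray_top (m i : ℕ) (hm : 1 ≤ m) (hi : i < 2 ^ m) :
    Nat.testBit (i ^^^ (i / 2)) (m - 1) = Nat.testBit i (m - 1) := by
  rw [gray_tb, Nat.sub_add_cancel hm, Nat.testBit_lt_two_pow hi]
  simp

lemma gray_sum (m k : ℕ) (hk : k + 1 < m) :
    ∑ i ∈ Finset.range (2 ^ m), bsg (Nat.testBit (i ^^^ (i / 2)) k) * xpam m i = 0 := by
  apply sum_refl m (fun i => bsg (Nat.testBit (i ^^^ (i / 2)) k))
  intro i hi
  simp only [gray_tb]
  rw [tb_refl m i k hi (by omega), tb_refl m i (k + 1) hi hk]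
  simp

lemma sum_sq (n : ℕ) (a : ℝ) : ∑ i ∈ Finset.range n, (2 * (i : ℝ) + 1 - a) ^ 2
    = n * (4 * n ^ 2 - 1) / 3 - 2 * a * n ^ 2 + n * a ^ 2 := by
  induction n with
  | zero => simp
  | succ n ih => rw [Finset.sum_range_succ, ih]; push_cast; ring

lemma energy (m : ℕ) : (2 ^ m : ℝ)⁻¹ * ∑ i ∈ Finset.range (2 ^ m), xpam m i ^ 2
    = ((2 ^ m : ℝ) ^ 2 - 1) / 3 := by
  simp only [xpam]
  rw [sum_sq]
  push_cast
  have : (2 ^ m : ℝ) ≠ 0 := by positivity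
  field_simp
  ring

/-- If only the top column has a nonzero sum, equal to that of the top bit. -/
lemma alpha_top (m : ℕ) (hm : 3 ≤ m) (c : ℕ → ℕ → Bool)
    (h0 : ∀ k, k + 1 < m → ∑ i ∈ Finset.range (2 ^ m), Qmat m c i k * xpam m i = 0)
    (h1 : ∀ i, i < 2 ^ m → c i 0 = Nat.testBit i (m - 1)) :
    alpha1 m c (xpam m)
      = 3 * (2^m : ℝ)^2 / (4 * ((2^m : ℝ)^2 - 1)) * Real.logb 2 (Real.exp 1) := by
  obtain ⟨n, rfl⟩ : ∃ n, m = n + 1 := ⟨m - 1, by omega⟩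
  unfold alpha1
  rw [energy, Finset.sum_range_succ, Finset.sum_eq_zero, zero_add]
  · have : ∑ i ∈ Finset.range (2 ^ (n + 1)), Qmat (n + 1) c i n * xpam (n + 1) i
        = - 2 ^ (n + 1) * 2 ^ n := by
      rw [← sum_bit (n + 1) n (by omega)]
      apply Finset.sum_congr rfl
      intro i hi
      have := h1 i (Finset.mem_range.mp hi)
      simp only [Nat.add_sub_cancel] at this
      simp [Qmat, bsg, this]
    rw [this]
    have h2 : (1 : ℝ) < (2 ^ (n + 1)) ^ 2 := by
      rw [← pow_mul]; exact one_lt_pow₀ (by norm_num) (by omega)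
    have h3 : ((2 ^ (n + 1) : ℝ)) ^ 2 - 1 ≠ 0 := by linarith
    have h4 : (2 ^ (n + 1) : ℝ)⁻¹ * (- 2 ^ (n + 1) * 2 ^ n) = - (2 ^ (n + 1)) / 2 := by
      have : (2 ^ (n + 1) : ℝ) ≠ 0 := by positivity
      field_simp
      ring
    rw [h4]
    generalize (2 ^ (n + 1) : ℝ) = M at *
    field_simp
    try ring
  · intro k hk
    rw [h0 k (by have := Finset.mem_range.mp hk; omega)]
    simp

/-- First-order coefficients of `M`-PAM (whose `Es = (M²-1)/3`) under the BRGC, FBC,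
NBC, and BSGC. -/
theorem alpha_pam (m : ℕ) (hm : 3 ≤ m) :
    alpha1 m (brgc m) (xpam m)
        = 3 * (2^m : ℝ)^2 / (4 * ((2^m : ℝ)^2 - 1)) * Real.logb 2 (Real.exp 1) ∧
    alpha1 m (fbc m) (xpam m)
        = 3 * (2^m : ℝ)^2 / (4 * ((2^m : ℝ)^2 - 1)) * Real.logb 2 (Real.exp 1) ∧
    alpha1 m (nbc m) (xpam m) = Real.logb 2 (Real.exp 1) ∧
    alpha1 m (bsgc m) (xpam m) = 0 := by
  have hQg : ∀ k, k + 1 < m → ∀ i, Qmat m (brgc m) i k = bsg (Nat.testBit (i ^^^ (i / 2)) k) := by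
    intro k hk i
    simp [Qmat, brgc, bsg, show m - 1 - (m - 1 - k) = k by omega]
  refine ⟨?_, ?_, ?_, ?_⟩
  · apply alpha_top m hm
    · intro k hk
      simp only [hQg k hk]
      exact gray_sum m k hk
    · intro i hi
      simp only [brgc, Nat.sub_zero]
      exact gray_top m i (by omega) hi
  · have h2m : 2 ^ m = 2 * 2 ^ (m - 1) := by
      rw [← pow_succ', Nat.sub_add_cancel (by omega)]
    apply alpha_top m hm
    · intro k hk
      apply sum_refl m (fun i => Qmat m (fbc m) i k)
      intro i hi
      have hne : m - 1 - k ≠ 0 := by omega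
      have hinv : 2 ^ m - 1 - (2 ^ m - 1 - i) = i := by omega
      simp only [Qmat, fbc, hne, if_false, hinv]
      by_cases h : i < 2 ^ (m - 1)
      · have h' : ¬ (2 ^ m - 1 - i < 2 ^ (m - 1)) := by omega
        simp only [h, h', if_true, if_false]
      · have h' : 2 ^ m - 1 - i < 2 ^ (m - 1) := by omega
        simp only [h, h', if_true, if_false]
    · intro i hi
      simp only [fbc, if_true]
      by_cases h : i < 2 ^ (m - 1)
      · rw [Nat.testBit_lt_two_pow h]; simpa using h
      · have h' : 2 ^ (m - 1) ≤ i := by omega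
        have : i = 2 ^ (m - 1) + (i - 2 ^ (m - 1)) := by omega
        rw [this, Nat.testBit_two_pow_add_eq, Nat.testBit_lt_two_pow (by omega)]
        simp
  · unfold alpha1
    rw [energy]
    have hs : ∀ k ∈ Finset.range m,
        ((2^m : ℝ)⁻¹ * ∑ i ∈ Finset.range (2^m), Qmat m (nbc m) i k * xpam m i)^2 = 4 ^ k := by
      intro k hk
      have hk' := Finset.mem_range.mp hk
      have : ∑ i ∈ Finset.range (2^m), Qmat m (nbc m) i k * xpam m i = - 2 ^ m * 2 ^ k := by
        rw [← sum_bit m k hk']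
        apply Finset.sum_congr rfl
        intro i _
        simp [Qmat, nbc, bsg, show m - 1 - (m - 1 - k) = k by omega]
      have h0 : (2 ^ m : ℝ) ≠ 0 := by positivity
      rw [this, show (2 ^ m : ℝ)⁻¹ * (- 2 ^ m * 2 ^ k) = - 2 ^ k by field_simp, neg_sq,
        ← pow_mul, mul_comm k 2, pow_mul]
      norm_num
    rw [Finset.sum_congr rfl hs, geom_sum_eq (by norm_num)]
    have h4 : (4 : ℝ) ^ m = (2 ^ m) ^ 2 := by
      rw [← pow_mul, mul_comm m 2, pow_mul]; norm_num
    have h2 : (1 : ℝ) < (2 ^ m) ^ 2 := by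
      rw [← pow_mul]; exact one_lt_pow₀ (by norm_num) (by omega)
    have h3 : ((2 ^ m : ℝ)) ^ 2 - 1 ≠ 0 := by linarith
    rw [h4]
    generalize (2 ^ m : ℝ) = M at *
    field_simp
    norm_num
  · unfold alpha1
    apply mul_eq_zero_of_right
    apply Finset.sum_eq_zero
    intro k hk
    have hk' := Finset.mem_range.mp hk
    suffices h : ∑ i ∈ Finset.range (2^m), Qmat m (bsgc m) i k * xpam m i = 0 by
      rw [h]; simp
    by_cases hkm : k + 1 < m
    · rw [← gray_sum m k hkm]
      apply Finset.sum_congr rfl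
      intro i _
      rw [← hQg k hkm]
      have hne : m - 1 - k ≠ 0 := by omega
      simp only [Qmat, bsgc, hne, if_false]
    · obtain ⟨n, rfl⟩ : ∃ n, m = n + 3 := ⟨m - 3, by omega⟩
      obtain rfl : k = n + 2 := by omega
      rw [← sum_three n]
      apply Finset.sum_congr rfl
      intro i hi
      have ht := gray_top (n + 3) i (by omega) (Finset.mem_range.mp hi)
      have e : n + 3 - 1 = n + 2 := by omega
      rw [e] at ht
      simp only [Qmat, bsgc, brgc, e, Nat.sub_self, if_true, Nat.sub_zero, ht, gray_tb i 0, bsg,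
        zero_add]
end

section
/- Let m ≥ 3, M = 2^m, and let X_PSK be the M-PSK input alphabet (Es = 1). Then the first-order coefficient α(X_PSK, L) of the constellation [X_PSK, L, U_M] equals: 8·log₂ e/(M²·sin²(π/M)) if L is the binary reflected Gray code G_m; 4·log₂ e/(M²·sin²(π/M)) if L is the natural binary code N_m; (4·log₂ e/(M²·sin²(π/M)))·[1 + (1 − 1/cos(2π/M))²] if L is the binary semi-Gray code S_m; and (4·log₂ e/(M²·sin²(π/M)))·[1 + Σ_{k=2}^{m} tan²(π/2^k)] if L is the folded binary code F_m. -/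
/-- The first-order coefficient `α(X,L) = (log₂ e / Es)·Σ_k ‖(1/M) Σ_i q_{i,k} x_i‖²`
of a two-dimensional constellation with uniform input distribution. -/
noncomputable def alpha2 (m : ℕ) (c : ℕ → ℕ → Bool)
    (x : ℕ → EuclideanSpace ℝ (Fin 2)) : ℝ :=
  (Real.logb 2 (Real.exp 1) /
      ((2^m : ℝ)⁻¹ * ∑ i ∈ Finset.range (2^m), ‖x i‖^2)) *
    ∑ k ∈ Finset.range m,
      ‖(2^m : ℝ)⁻¹ • ∑ i ∈ Finset.range (2^m), Qmat m c i k • x i‖^2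

/-- sign of bit `j` of `i` -/
def sgn (j i : ℕ) : ℝ := if Nat.testBit i j then -1 else 1

lemma sum_prod_sgn (A : Finset ℕ) (w : ℂ) (m : ℕ) :
    ∑ i ∈ Finset.range (2^m), ((∏ j ∈ Finset.range m, (if j ∈ A then sgn j i else 1) : ℝ) : ℂ) * w^i
      = ∏ j ∈ Finset.range m, (1 + (if j ∈ A then -1 else 1) * w^(2^j)) := by
  induction m with
  | zero => simp
  | succ m ih =>
    rw [pow_succ, mul_two, Finset.sum_range_add, Finset.prod_range_succ, ← ih, mul_add, mul_one,
      Finset.sum_mul]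
    congr 1
    · apply Finset.sum_congr rfl
      intro i hi
      rw [Finset.mem_range] at hi
      rw [Finset.prod_range_succ]
      have : sgn m i = 1 := by simp [sgn, Nat.testBit_lt_two_pow hi]
      simp [this]
    · apply Finset.sum_congr rfl
      intro i hi
      rw [Finset.mem_range] at hi
      rw [Finset.prod_range_succ]
      have h1 : sgn m (2^m + i) = -1 := by
        simp [sgn, Nat.testBit_two_pow_add_eq, Nat.testBit_lt_two_pow hi]
      have h2 : ∏ j ∈ Finset.range m, (if j ∈ A then sgn j (2^m+i) else 1)
          = ∏ j ∈ Finset.range m, (if j ∈ A then sgn j i else 1) := by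
        apply Finset.prod_congr rfl
        intro j hj
        rw [Finset.mem_range] at hj
        simp [sgn, Nat.testBit_two_pow_add_gt hj]
      rw [h1, h2, pow_add]
      push_cast
      split_ifs <;> push_cast <;> ring

lemma prod_sgn_eq (A : Finset ℕ) (m : ℕ) (hA : A ⊆ Finset.range m) (f : ℕ → ℝ) :
    ∏ j ∈ Finset.range m, (if j ∈ A then f j else 1) = ∏ j ∈ A, f j := by
  rw [Finset.prod_ite_mem, Finset.inter_eq_right.mpr hA]

lemma cos_prod (θ : ℝ) (n : ℕ) :
    Real.sin θ ^ 2 * ∏ j ∈ Finset.range n, (4 * Real.cos (2^j * θ)^2) = Real.sin (2^n * θ)^2 := by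
  induction n with
  | zero => simp
  | succ n ih =>
    rw [Finset.prod_range_succ, ← mul_assoc, ih, pow_succ (2:ℝ) n,
      show (2:ℝ)^n * 2 * θ = 2 * (2^n * θ) by ring, Real.sin_two_mul]
    ring

lemma normSq_factor (A : Finset ℕ) (θ : ℝ) (j : ℕ) :
    ‖1 + (if j ∈ A then -1 else 1) * (Complex.exp ((2 * θ : ℝ) * Complex.I))^(2^j)‖^2
      = if j ∈ A then 4 * Real.sin (2^j*θ)^2 else 4 * Real.cos (2^j * θ)^2 := by
  rw [← Complex.exp_nat_mul]
  have : ((2^j : ℕ) : ℂ) * (((2 * θ : ℝ) : ℂ) * Complex.I)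
      = ((2 * (2^j*θ) : ℝ) : ℂ) * Complex.I := by push_cast; ring
  rw [this]
  generalize 2^j*θ = φ
  have h := Real.sin_sq_add_cos_sq φ
  rw [← Complex.normSq_eq_norm_sq, Complex.normSq_apply]
  have hs := Real.sin_two_mul φ
  have hc := Real.cos_two_mul φ
  split_ifs
  · simp only [Complex.add_re, Complex.add_im, neg_one_mul, Complex.neg_re, Complex.neg_im,
      Complex.exp_ofReal_mul_I_re, Complex.exp_ofReal_mul_I_im, Complex.one_re, Complex.one_im,
      hs, hc]
    have : Real.sin φ^2 = 1 - Real.cos φ^2 := by linarith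
    ring_nf
    simp only [this]
    ring
  · simp only [Complex.add_re, Complex.add_im, one_mul,
      Complex.exp_ofReal_mul_I_re, Complex.exp_ofReal_mul_I_im, Complex.one_re, Complex.one_im,
      hs, hc]
    have : Real.sin φ^2 = 1 - Real.cos φ^2 := by linarith
    ring_nf
    simp only [this]
    ring

lemma norm_vec (m : ℕ) (q : ℕ → ℝ) :
    ‖(2^m : ℝ)⁻¹ • ∑ i ∈ Finset.range (2^m), q i • xpsk m i‖^2
      = ((2^m : ℝ)^2)⁻¹ * ‖∑ i ∈ Finset.range (2^m), (q i : ℂ) *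
          (Complex.exp ((2 * (Real.pi / 2^m) : ℝ) * Complex.I))^i‖^2 := by
  have hx : ∀ i, xpsk m i = Complex.orthonormalBasisOneI.repr
      (Complex.exp ((Real.pi / 2^m : ℝ) * Complex.I) *
        (Complex.exp ((2 * (Real.pi / 2^m) : ℝ) * Complex.I))^i) := by
    intro i
    have : Complex.exp ((Real.pi / 2^m : ℝ) * Complex.I) *
        (Complex.exp ((2 * (Real.pi / 2^m) : ℝ) * Complex.I))^i
        = Complex.exp ((((2 * (i:ℝ) + 1) * Real.pi / 2^m : ℝ) : ℂ) * Complex.I) := by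
      rw [← Complex.exp_nat_mul, ← Complex.exp_add]
      congr 1
      push_cast
      ring
    rw [this]
    ext k
    fin_cases k
    · simp only [xpsk, Complex.orthonormalBasisOneI_repr_apply, Complex.exp_ofReal_mul_I_re,
        Complex.exp_ofReal_mul_I_im]
      simp
    · simp only [xpsk, Complex.orthonormalBasisOneI_repr_apply, Complex.exp_ofReal_mul_I_re,
        Complex.exp_ofReal_mul_I_im]
      simp
  have : ∑ i ∈ Finset.range (2^m), q i • xpsk m i = Complex.orthonormalBasisOneI.repr
      (Complex.exp ((Real.pi / 2^m : ℝ) * Complex.I) *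
       ∑ i ∈ Finset.range (2^m), (q i : ℂ) *
          (Complex.exp ((2 * (Real.pi / 2^m) : ℝ) * Complex.I))^i) := by
    rw [Finset.mul_sum, map_sum]
    apply Finset.sum_congr rfl
    intro i _
    rw [hx, ← map_smul, Complex.real_smul]
    congr 1
    ring
  rw [this, norm_smul, LinearIsometryEquiv.norm_map, norm_mul, Complex.norm_exp_ofReal_mul_I,
    one_mul, mul_pow, norm_inv, inv_pow]
  simp

lemma cos_ne (n j : ℕ) (hj : j < n) : Real.cos (2^j * (Real.pi / 2^(n+1))) ≠ 0 := by
  apply ne_of_gt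
  have hp := Real.pi_pos
  apply Real.cos_pos_of_mem_Ioo
  constructor
  · have : 0 < 2^j * (Real.pi / 2^(n+1)) := by positivity
    linarith
  · have h : (2:ℝ)^j < 2^n := pow_lt_pow_right₀ (by norm_num) hj
    rw [pow_succ, ← mul_div_assoc, div_lt_div_iff₀ (by positivity) (by norm_num)]
    nlinarith

lemma sin_ne (n : ℕ) : Real.sin (Real.pi / 2^(n+1)) ≠ 0 := by
  apply ne_of_gt
  have hp := Real.pi_pos
  apply Real.sin_pos_of_pos_of_lt_pi (by positivity)
  apply div_lt_self hp
  exact one_lt_pow₀ (by norm_num) (by omega)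

lemma key_s14 (n : ℕ) (A : Finset ℕ) (hA : A ⊆ Finset.range (n+1)) (q : ℕ → ℝ)
    (hq : ∀ i < 2^(n+1), q i = ∏ j ∈ A, sgn j i) :
    ‖(2^(n+1) : ℝ)⁻¹ • ∑ i ∈ Finset.range (2^(n+1)), q i • xpsk (n+1) i‖^2
      = if n ∈ A then 4 / ((2^(n+1) : ℝ)^2 * Real.sin (Real.pi / 2^(n+1))^2) *
          ∏ j ∈ A.erase n, Real.tan (2^j * (Real.pi / 2^(n+1)))^2 else 0 := by
  rw [norm_vec]
  have h1 : ∑ i ∈ Finset.range (2^(n+1)), (q i : ℂ) *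
          (Complex.exp ((2 * (Real.pi / 2^(n+1)) : ℝ) * Complex.I))^i
      = ∏ j ∈ Finset.range (n+1), (1 + (if j ∈ A then -1 else 1) *
          (Complex.exp ((2 * (Real.pi / 2^(n+1)) : ℝ) * Complex.I))^(2^j)) := by
    rw [← sum_prod_sgn]
    apply Finset.sum_congr rfl
    intro i hi
    rw [hq i (Finset.mem_range.mp hi), prod_sgn_eq A _ hA (fun j => sgn j i)]
  rw [h1, norm_prod, ← Finset.prod_pow]
  simp only [normSq_factor]
  rw [Finset.prod_range_succ]
  have h2 : (2:ℝ)^n * (Real.pi / 2^(n+1)) = Real.pi / 2 := by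
    rw [pow_succ]; field_simp
  have h3 := cos_prod (Real.pi / 2^(n+1)) n
  rw [h2] at *
  simp only [Real.sin_pi_div_two, Real.cos_pi_div_two] at *
  split_ifs with hn
  · have h4 : ∏ j ∈ Finset.range n, (if j ∈ A then 4 * Real.sin (2^j * (Real.pi / 2^(n+1)))^2
          else 4 * Real.cos (2^j * (Real.pi / 2^(n+1)))^2)
        = (∏ j ∈ Finset.range n, (4 * Real.cos (2^j * (Real.pi / 2^(n+1)))^2)) *
          ∏ j ∈ A.erase n, Real.tan (2^j * (Real.pi / 2^(n+1)))^2 := by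
      rw [← prod_sgn_eq (A.erase n) n, ← Finset.prod_mul_distrib]
      · apply Finset.prod_congr rfl
        intro j hj
        have hj := Finset.mem_range.mp hj
        have := cos_ne n j hj
        have hne : j ≠ n := by omega
        simp only [Finset.mem_erase, hne, ne_eq, not_false_eq_true, true_and]
        split_ifs
        · rw [Real.tan_eq_sin_div_cos, div_pow]
          exact (by
            rw [mul_assoc, mul_div_cancel₀ _ (pow_ne_zero 2 this)])
        · simp
      · intro j hj
        have h5 := Finset.mem_erase.mp hj
        have := Finset.mem_range.mp (hA h5.2)
        exact Finset.mem_range.mpr (by omega)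
    rw [h4]
    have hs := sin_ne n
    have h5 : (∏ j ∈ Finset.range n, (4 * Real.cos (2^j * (Real.pi / 2^(n+1)))^2))
        = 1 / Real.sin (Real.pi / 2^(n+1))^2 := by
      rw [eq_div_iff (by positivity), mul_comm, h3]; norm_num
    rw [h5]
    field_simp
  · simp

lemma alpha2_eq (m : ℕ) (c : ℕ → ℕ → Bool) :
    alpha2 m c (xpsk m) = Real.logb 2 (Real.exp 1) * ∑ k ∈ Finset.range m,
      ‖(2^m : ℝ)⁻¹ • ∑ i ∈ Finset.range (2^m), Qmat m c i k • xpsk m i‖^2 := by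
  have : ∀ i, ‖xpsk m i‖^2 = 1 := by
    intro i
    rw [EuclideanSpace.norm_sq_eq]
    simp [xpsk]
  simp [alpha2, this]

lemma testBit_compl (m i k : ℕ) (hi : i < 2^m) (hk : k < m) :
    Nat.testBit (2^m - 1 - i) k = !Nat.testBit i k := by
  have := Nat.testBit_two_pow_sub_succ hi k
  rw [show 2^m - 1 - i = 2^m - (i+1) by omega, this]
  simp [hk]

lemma sgn_top (n i : ℕ) (hi : i < 2^(n+1)) : sgn n i = if 2^n ≤ i then -1 else 1 := by
  unfold sgn
  split_ifs with h1 h2 h2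
  · rfl
  · rw [Nat.testBit_lt_two_pow (by omega)] at h1; simp at h1
  · exfalso; apply h1
    obtain ⟨r, rfl⟩ := Nat.exists_eq_add_of_le h2
    rw [Nat.testBit_two_pow_add_eq, Nat.testBit_lt_two_pow (by rw [pow_succ] at hi; omega)]; rfl
  · rfl

lemma q_brgc (n i k : ℕ) (hk : k < n) :
    (if brgc (n+1) i (n - k) then (-1:ℝ) else 1) = sgn k i * sgn (k+1) i := by
  have : n - (n - k) = k := by omega
  simp only [brgc, sgn, Nat.add_sub_cancel, this, Nat.testBit_xor, Nat.testBit_div_two]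
  cases Nat.testBit i k <;> cases Nat.testBit i (k+1) <;> simp

lemma q_brgc_top (n i : ℕ) (hi : i < 2^(n+1)) :
    (if brgc (n+1) i 0 then (-1:ℝ) else 1) = sgn n i := by
  simp [brgc, sgn, Nat.testBit_xor, Nat.testBit_div_two, Nat.testBit_lt_two_pow hi]

/-- First-order coefficients of `M`-PSK (`Es = 1`) under the BRGC, NBC, BSGC, and FBC. -/
theorem alpha_psk (m : ℕ) (hm : 3 ≤ m) :
    alpha2 m (brgc m) (xpsk m)
        = 8 * Real.logb 2 (Real.exp 1) /
            ((2^m : ℝ)^2 * Real.sin (Real.pi / 2^m)^2) ∧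
    alpha2 m (nbc m) (xpsk m)
        = 4 * Real.logb 2 (Real.exp 1) /
            ((2^m : ℝ)^2 * Real.sin (Real.pi / 2^m)^2) ∧
    alpha2 m (bsgc m) (xpsk m)
        = 4 * Real.logb 2 (Real.exp 1) /
            ((2^m : ℝ)^2 * Real.sin (Real.pi / 2^m)^2) *
          (1 + (1 - 1 / Real.cos (2 * Real.pi / 2^m))^2) ∧
    alpha2 m (fbc m) (xpsk m)
        = 4 * Real.logb 2 (Real.exp 1) /
            ((2^m : ℝ)^2 * Real.sin (Real.pi / 2^m)^2) *
          (1 + ∑ k ∈ Finset.Icc 2 m, Real.tan (Real.pi / 2^k)^2) := by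
  obtain ⟨n, rfl⟩ : ∃ n, m = n + 1 := ⟨m - 1, by omega⟩
  have hgray : ∀ k < n, ‖(2^(n+1) : ℝ)⁻¹ • ∑ i ∈ Finset.range (2^(n+1)),
      (if brgc (n+1) i (n - k) then (-1:ℝ) else 1) • xpsk (n+1) i‖^2
      = if k = n - 1 then 4 / ((2^(n+1) : ℝ)^2 * Real.sin (Real.pi / 2^(n+1))^2) else 0 := by
    intro k hk
    rw [key_s14 n {k, k+1}]
    · have h1 : n ≠ k := by omega
      by_cases h2 : k = n - 1
      · have h3 : n = k + 1 := by omega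
        subst h3
        have h4 : (2:ℝ)^k * (Real.pi / 2^(k+1+1)) = Real.pi / 4 := by
          rw [pow_succ, pow_succ]; field_simp; norm_num
        have h5 : ({k, k+1} : Finset ℕ).erase (k+1) = {k} := by
          ext j; simp; omega
        rw [h5]
        simp [h4]
      · have h3 : ¬ n = k + 1 := by omega
        simp [h1, h2, h3]
    · intro j hj
      simp at hj ⊢
      omega
    · intro i _
      rw [Finset.prod_pair (by omega)]
      exact q_brgc n i k hk
  have hself : (({n} : Finset ℕ).erase n) = ∅ := by simp
  refine ⟨?_, ?_, ?_, ?_⟩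
  · rw [alpha2_eq, Finset.sum_range_succ]
    simp only [Qmat, Nat.add_sub_cancel]
    rw [Finset.sum_congr rfl (fun k hk => hgray k (Finset.mem_range.mp hk)), Finset.sum_ite_eq',
      Nat.sub_self, key_s14 n {n} (by simp) _ (fun i hi => by
        rw [Finset.prod_singleton]; exact q_brgc_top n i hi)]
    have : n - 1 < n := by omega
    simp only [Finset.mem_range, this, Finset.mem_singleton, if_true, hself, Finset.prod_empty]
    ring
  · rw [alpha2_eq]
    have : ∀ k ∈ Finset.range (n+1), ‖(2^(n+1) : ℝ)⁻¹ • ∑ i ∈ Finset.range (2^(n+1)),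
        Qmat (n+1) (nbc (n+1)) i k • xpsk (n+1) i‖^2
        = if k = n then 4 / ((2^(n+1) : ℝ)^2 * Real.sin (Real.pi / 2^(n+1))^2) else 0 := by
      intro k hk
      have hk := Finset.mem_range.mp hk
      rw [key_s14 n {k} (by simpa using hk)]
      · by_cases h : k = n
        · subst h; simp
        · simp [h, Ne.symm h]
      · intro i hi
        have : n - (n - k) = k := by omega
        simp [Qmat, nbc, sgn, this]
    rw [Finset.sum_congr rfl this, Finset.sum_ite_eq']
    simp only [Finset.mem_range, Nat.lt_succ_self, if_true]
    ring
  · rw [alpha2_eq, Finset.sum_range_succ]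
    simp only [Qmat, Nat.add_sub_cancel]
    have hg : ∀ k ∈ Finset.range n, ‖(2^(n+1) : ℝ)⁻¹ • ∑ i ∈ Finset.range (2^(n+1)),
      (if bsgc (n+1) i (n - k) then (-1:ℝ) else 1) • xpsk (n+1) i‖^2
      = if k = n - 1 then 4 / ((2^(n+1) : ℝ)^2 * Real.sin (Real.pi / 2^(n+1))^2) else 0 := by
      intro k hk
      have hk := Finset.mem_range.mp hk
      rw [← hgray k hk]
      have : n - k ≠ 0 := by omega
      simp only [bsgc, this, if_false]
    rw [Finset.sum_congr rfl hg, Finset.sum_ite_eq', Nat.sub_self, key_s14 n {0, 1, n}]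
    · have h0 : n - 1 < n := by omega
      have h1 : ({0, 1, n} : Finset ℕ).erase n = {0, 1} := by
        ext j; simp; omega
      have h2 : n ∈ ({0, 1, n} : Finset ℕ) := by simp
      rw [h1, Finset.prod_pair (by norm_num)]
      simp only [Finset.mem_range, h0, h2, if_true, pow_zero, pow_one, one_mul]
      have hc0 := cos_ne n 0 (by omega)
      have hc1 := cos_ne n 1 (by omega)
      rw [show 2 * Real.pi / 2^(n+1) = 2 * (Real.pi / 2^(n+1)) by ring]
      simp only [pow_zero, pow_one, one_mul] at hc0 hc1
      generalize Real.pi / 2^(n+1) = θ at *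
      have h3 : Real.tan θ ^2 * Real.tan (2*θ)^2 = (1 - 1 / Real.cos (2*θ))^2 := by
        rw [← mul_pow, ← neg_sq]
        congr 1
        have hs := Real.sin_sq_add_cos_sq θ
        rw [Real.tan_eq_sin_div_cos, Real.tan_eq_sin_div_cos, Real.sin_two_mul]
        field_simp
        rw [Real.cos_two_mul]
        linarith
      rw [h3]
      ring
    · intro j hj
      simp at hj ⊢
      omega
    · intro i hi
      rw [Finset.prod_insert (by simp; omega), Finset.prod_pair (by omega)]
      have h1 := q_brgc n i 0 (by omega)
      have h2 := q_brgc_top n i hi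
      rw [← mul_assoc, ← h2, ← h1]
      simp only [bsgc, if_true, Nat.sub_zero, Nat.add_sub_cancel]
      cases brgc (n+1) i 0 <;> cases brgc (n+1) i n <;> simp
  · rw [alpha2_eq, Finset.sum_range_succ]
    simp only [Qmat, Nat.add_sub_cancel]
    have hg : ∀ k ∈ Finset.range n, ‖(2^(n+1) : ℝ)⁻¹ • ∑ i ∈ Finset.range (2^(n+1)),
      (if fbc (n+1) i (n - k) then (-1:ℝ) else 1) • xpsk (n+1) i‖^2
      = 4 / ((2^(n+1) : ℝ)^2 * Real.sin (Real.pi / 2^(n+1))^2) *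
        Real.tan (2^k * (Real.pi / 2^(n+1)))^2 := by
      intro k hk
      have hk := Finset.mem_range.mp hk
      rw [key_s14 n {k, n}]
      · have h1 : ({k, n} : Finset ℕ).erase n = {k} := by
          ext j; simp; omega
        rw [h1]; simp
      · intro j hj
        simp at hj ⊢
        omega
      · intro i hi
        rw [Finset.prod_pair (by omega), sgn_top n i hi]
        have h0 : n - k ≠ 0 := by omega
        have h1 : n - (n - k) = k := by omega
        simp only [fbc, h0, if_false, Nat.add_sub_cancel, h1, sgn,
          testBit_compl (n+1) i k hi (by omega)]
        by_cases h : 2^n ≤ i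
        · have h' : ¬ i < 2^n := by omega
          cases Nat.testBit i k <;> simp [h, h']
        · have h' : i < 2^n := by omega
          cases Nat.testBit i k <;> simp [h, h']
    rw [Finset.sum_congr rfl hg, Nat.sub_self, ← Finset.mul_sum,
      key_s14 n {n} (by simp) _ (fun i hi => by
        rw [Finset.prod_singleton, sgn_top n i hi]; simp [fbc])]
    have hsum : ∑ k ∈ Finset.range n, Real.tan (2^k * (Real.pi / 2^(n+1)))^2
        = ∑ k ∈ Finset.Icc 2 (n+1), Real.tan (Real.pi / 2^k)^2 := by
      apply Finset.sum_bij (fun k _ => n + 1 - k)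
      · intro k hk; simp at hk ⊢; omega
      · intro a ha b hb h; simp at ha hb h; omega
      · intro b hb
        simp at hb
        exact ⟨n + 1 - b, by simp; omega, by omega⟩
      · intro k hk
        simp at hk
        have h : (2:ℝ)^(n+1) = 2^k * 2^(n+1-k) := by
          rw [← pow_add]; congr 1; omega
        rw [h]
        congr 2
        field_simp
    rw [hsum]
    simp only [Finset.mem_singleton, if_true, hself, Finset.prod_empty]
    ring
end

section
/- Let m ≥ 3 and M = 2^m. Then Σ_{k=0}^{M/8−1} [ sin((1+8k)π/M) − sin((3+8k)π/M) ] = −sin(π/M)/cos(2π/M). (This closed-form sum determines the contribution of the first bit position of the binary semi-Gray code to the first-order coefficient for M-PSK.) -/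
lemma bsgc_aux (x : ℝ) (n : ℕ) :
    (∑ k ∈ Finset.range n,
        (Real.sin ((1 + 8*(k:ℝ)) * x) - Real.sin ((3 + 8*(k:ℝ)) * x))) * Real.sin (4 * x)
      = - Real.sin x * (Real.sin (8 * (n:ℝ) * x - 2 * x) + Real.sin (2 * x)) := by
  induction n with
  | zero => simp
  | succ n ih =>
    rw [Finset.sum_range_succ, add_mul, ih]
    have h1 : (1 + 8*(n:ℝ)) * x = (8 * n + 2) * x - x := by ring
    have h2 : (3 + 8*(n:ℝ)) * x = (8 * n + 2) * x + x := by ring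
    have h3 : 8 * (n:ℝ) * x - 2 * x = (8 * n + 2) * x - 4 * x := by ring
    have h4 : 8 * ((n + 1 : ℕ):ℝ) * x - 2 * x = (8 * n + 2) * x + 4 * x := by
      push_cast; ring
    rw [h1, h2, h3, h4]
    generalize (8 * (n:ℝ) + 2) * x = y
    rw [Real.sin_sub, Real.sin_add, Real.sin_sub, Real.sin_add]
    ring

/-- Closed-form trigonometric sum determining the contribution of the first bit
position of the binary semi-Gray code to the first-order coefficient for `M`-PSK:
`Σ_{k=0}^{M/8-1} [sin((1+8k)π/M) - sin((3+8k)π/M)] = -sin(π/M)/cos(2π/M)`. -/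
theorem bsgc_psk_sum (m : ℕ) (hm : 3 ≤ m) :
    ∑ k ∈ Finset.range (2^m / 8),
        (Real.sin ((1 + 8*(k:ℝ)) * Real.pi / 2^m)
          - Real.sin ((3 + 8*(k:ℝ)) * Real.pi / 2^m))
      = - Real.sin (Real.pi / 2^m) / Real.cos (2 * Real.pi / 2^m) := by
  obtain ⟨j, rfl⟩ := Nat.exists_eq_add_of_le hm
  have hn : 2 ^ (3 + j) / 8 = 2 ^ j := by
    rw [pow_add]; norm_num
  have hj : (1:ℝ) ≤ 2 ^ j := one_le_pow₀ (by norm_num)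
  have hM : (2:ℝ) ^ (3 + j) = 8 * 2 ^ j := by rw [pow_add]; norm_num
  rw [hn, hM]
  simp only [mul_div_assoc]
  have h := bsgc_aux (Real.pi / (8 * 2 ^ j)) (2 ^ j)
  have hx8 : 8 * (2:ℝ) ^ j * (Real.pi / (8 * 2 ^ j)) = Real.pi := by
    field_simp
  have hxpos : 0 < Real.pi / (8 * 2 ^ j) := by positivity
  have hxle : Real.pi / (8 * 2 ^ j) ≤ Real.pi / 8 := by
    apply div_le_div_of_nonneg_left Real.pi_pos.le (by norm_num) (by linarith)
  push_cast at h
  rw [hx8] at h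
  generalize Real.pi / (8 * 2 ^ j) = x at *
  have hpi := Real.pi_pos
  have hs : 0 < Real.sin (2 * x) :=
    Real.sin_pos_of_pos_of_lt_pi (by linarith) (by linarith)
  have hc : 0 < Real.cos (2 * x) :=
    Real.cos_pos_of_mem_Ioo ⟨by linarith, by linarith⟩
  rw [Real.sin_pi_sub, show 4 * x = 2 * (2 * x) by ring, Real.sin_two_mul (2 * x)] at h
  rw [eq_div_iff hc.ne']
  have h2 : (2 * Real.sin (2 * x)) ≠ 0 := by positivity
  apply mul_right_cancel₀ h2
  linarith
end

section
/- Let m ≥ 2, M = 2^m, and let k be an integer with 1 ≤ k ≤ m−1. Then Σ_{j=0}^{2^{k−1}−1} Σ_{l=0}^{2^{m−k−1}−1} cos( (2^{m−k+1}·j + 2l + 1)·π/M ) = tan(π/2^{k+1}) / (2·sin(π/M)). (This closed-form double sum gives the per-bit contribution of the folded binary code to the first-order coefficient for M-PSK.) -/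
theorem fbc_inner (t x : ℝ) (n : ℕ) :
    (∑ l ∈ Finset.range n, Real.cos (x + (2 * (l : ℝ) + 1) * t)) * (2 * Real.sin t)
      = Real.sin (x + 2 * n * t) - Real.sin x := by
  induction n with
  | zero => simp
  | succ n ih =>
    rw [Finset.sum_range_succ, add_mul, ih]
    have h1 : x + 2 * ((n + 1 : ℕ) : ℝ) * t = (x + (2 * (n : ℝ) + 1) * t) + t := by
      push_cast; ring
    have h2 : x + 2 * (n : ℝ) * t = (x + (2 * (n : ℝ) + 1) * t) - t := by ring
    rw [h1, h2, Real.sin_add, Real.sin_sub]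
    ring

theorem fbc_outer (b : ℝ) (n : ℕ) :
    (∑ j ∈ Finset.range n, (Real.sin (2 * b * j + b) - Real.sin (2 * b * j)))
        * (2 * Real.sin b)
      = 1 - Real.cos (2 * b * n) - Real.cos b + Real.cos (2 * b * n - b) := by
  induction n with
  | zero => simp
  | succ n ih =>
    rw [Finset.sum_range_succ, add_mul, ih]
    have h1 : 2 * b * ((n + 1 : ℕ) : ℝ) = (2 * b * n + b) + b := by
      push_cast; ring
    have h2 : (2 * b * n + b) + b - b = 2 * b * n + b := by ring
    rw [h1, h2, Real.cos_add (2 * b * n + b) b, Real.sin_add, Real.cos_add, Real.cos_sub]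
    linear_combination (Real.cos (2 * b * n)) * Real.sin_sq_add_cos_sq b

/-- Closed-form double sum giving the per-bit contribution of the folded binary code
to the first-order coefficient for `M`-PSK:
`Σ_{j<2^{k-1}} Σ_{l<2^{m-k-1}} cos((2^{m-k+1}j + 2l + 1)π/M)
  = tan(π/2^{k+1}) / (2 sin(π/M))`. -/
theorem fbc_psk_sum (m : ℕ) (hm : 2 ≤ m) (k : ℕ) (hk1 : 1 ≤ k) (hk2 : k ≤ m - 1) :
    ∑ j ∈ Finset.range (2^(k-1)), ∑ l ∈ Finset.range (2^(m-k-1)),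
        Real.cos (((2^(m-k+1) * j + 2*l + 1 : ℕ) : ℝ) * Real.pi / 2^m)
      = Real.tan (Real.pi / 2^(k+1)) / (2 * Real.sin (Real.pi / 2^m)) := by
  obtain ⟨p, rfl⟩ : ∃ p, k = p + 1 := ⟨k - 1, by omega⟩
  obtain ⟨q, rfl⟩ : ∃ q, m = p + q + 2 := ⟨m - p - 2, by omega⟩
  have e1 : p + q + 2 - (p + 1) - 1 = q := by omega
  have e2 : p + q + 2 - (p + 1) + 1 = q + 2 := by omega
  rw [e1, e2, Nat.add_sub_cancel]
  set t : ℝ := Real.pi / 2 ^ (p + q + 2) with ht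
  set c : ℝ := Real.pi / 2 ^ (p + 1 + 1) with hc
  have hct : c = 2 ^ q * t := by
    rw [hc, ht]; field_simp; ring
  have hpi : 2 * (2 * c) * 2 ^ p = Real.pi := by
    rw [hc]; field_simp; ring
  have hone : ∀ n : ℕ, (1 : ℝ) < 2 ^ (n + 1) := fun n => one_lt_pow₀ (by norm_num) (by omega)
  have hst : 0 < Real.sin t := Real.sin_pos_of_pos_of_lt_pi (by positivity)
    (div_lt_self Real.pi_pos (hone _))
  have hcpos : 0 < c := by positivity
  have h1p : (1 : ℝ) ≤ 2 ^ p := one_le_pow₀ (by norm_num)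
  have hc4 : 4 * c ≤ Real.pi := by nlinarith
  have hsc : 0 < Real.sin c := Real.sin_pos_of_pos_of_lt_pi hcpos (by linarith)
  have hcc : 0 < Real.cos c := Real.cos_pos_of_mem_Ioo ⟨by linarith, by linarith⟩
  rw [eq_div_iff (by positivity), Finset.sum_mul]
  have key : ∀ j ∈ Finset.range (2 ^ p), (∑ l ∈ Finset.range (2 ^ q),
      Real.cos (((2 ^ (q + 2) * j + 2 * l + 1 : ℕ) : ℝ) * Real.pi / 2 ^ (p + q + 2)))
        * (2 * Real.sin t)
      = Real.sin (2 * (2 * c) * j + 2 * c) - Real.sin (2 * (2 * c) * j) := by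
    intro j _
    have h := fbc_inner t (2 * (2 * c) * j) (2 ^ q)
    have h3 : 2 * ((2 ^ q : ℕ) : ℝ) * t = 2 * c := by rw [hct]; push_cast; ring
    rw [h3] at h
    rw [← h]
    congr 1
    refine Finset.sum_congr rfl fun l _ => ?_
    congr 1
    rw [mul_div_assoc, ← ht, hct]
    push_cast
    ring
  rw [Finset.sum_congr rfl key]
  have h := fbc_outer (2 * c) (2 ^ p)
  have h4 : 2 * (2 * c) * ((2 ^ p : ℕ) : ℝ) = Real.pi := by rw [← hpi]; push_cast; ring
  rw [h4, Real.cos_pi, Real.cos_pi_sub, Real.sin_two_mul, Real.cos_two_mul] at h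
  rw [Real.tan_eq_sin_div_cos, eq_div_iff hcc.ne']
  apply mul_right_cancel₀ (mul_pos four_pos hsc).ne'
  linear_combination h + 4 * Real.sin_sq_add_cos_sq c * (-1)
end
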